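/- With L_x : x = 0, L_y : y = 0, L_z : z = 0: the curve C₀ ∪ L_x : x f₀ = 0 is nearly free with exponents (5,6); the curve C₀ ∪ L_y : y f₀ = 0 is a maximal Tjurina curve of type (11,6); the curve C₀ ∪ L_x ∪ L_y ∪ L_z : xyz f₀ = 0 is a maximal Tjurina curve of type (13,7); the curve C'₀ ∪ L_x : x f'₀ = 0 is free with exponents (5,5); the curve C'₀ ∪ L_y : y f'₀ = 0 is nearly free with exponents (5,6); and the curve C'₀ ∪ L_x ∪ L_y ∪ L_z : xyz f'₀ = 0 is nearly free with exponents (6,7). -/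

import Mathlib

open MvPolynomial

noncomputable section

/-- `S = ℂ[x,y,z]`, with `x = X 0`, `y = X 1`, `z = X 2`. -/
abbrev S3 := MvPolynomial (Fin 3) ℂ

/-- The graded `S`-module `D_0(f)` of Jacobian syzygies of `f`. -/
def jacSyz (f : S3) : Submodule S3 (Fin 3 → S3) where
  carrier := {v | v 0 * pderiv 0 f + v 1 * pderiv 1 f + v 2 * pderiv 2 f = 0}
  add_mem' := by
    intro a b ha hb
    simp only [Set.mem_setOf_eq, Pi.add_apply] at *
    linear_combination ha + hb
  zero_mem' := by simp
  smul_mem' := by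
    intro c v hv
    simp only [Set.mem_setOf_eq, Pi.smul_apply, smul_eq_mul] at *
    linear_combination c * hv

/-- `v` is a minimal system of `m` homogeneous generators of `D_0(f)`, the generator
`v j` being a syzygy of degree `dd j`, and `dd` nondecreasing: this says that
`C : f = 0` is an `m`-syzygy curve with exponents `dd`. -/
structure IsMinGenSyz (f : S3) (m : ℕ) (dd : Fin m → ℕ) (v : Fin m → (Fin 3 → S3)) : Prop where
  mem : ∀ j, v j ∈ jacSyz f
  hom : ∀ j i, ((v j) i).IsHomogeneous (dd j)
  ne_zero : ∀ j, v j ≠ 0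
  span_eq : Submodule.span S3 (Set.range v) = jacSyz f
  minimal : ∀ j, v j ∉ Submodule.span S3 (v '' {j' | j' ≠ j})
  mono : Monotone dd

/-- `C : f = 0` is free with exponents `(d1, d2)`. -/
def IsFreeWith (f : S3) (d1 d2 : ℕ) : Prop := ∃ v, IsMinGenSyz f 2 ![d1, d2] v

/-- `C : f = 0` is a free curve (a 2-syzygy curve). -/
def IsFreeCurve (f : S3) : Prop := ∃ d1 d2, IsFreeWith f d1 d2

/-- `C : f = 0` of degree `d` is nearly free with exponents `(d1, d2)`:
a 3-syzygy curve with exponents `(d1, d2, d2)` and `d1 + d2 = d`. -/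
def IsNearlyFreeWith (f : S3) (d d1 d2 : ℕ) : Prop :=
  d1 + d2 = d ∧ ∃ v, IsMinGenSyz f 3 ![d1, d2, d2] v

/-- `C : f = 0` of degree `d` is a nearly free curve. -/
def IsNearlyFree (f : S3) (d : ℕ) : Prop := ∃ d1 d2, IsNearlyFreeWith f d d1 d2

/-- `C : f = 0` of degree `d` is plus-one generated with exponents `(d1, d2, d3)`:
a 3-syzygy curve with `d1 + d2 = d`. -/
def IsPOGWith (f : S3) (d d1 d2 d3 : ℕ) : Prop :=
  d1 + d2 = d ∧ ∃ v, IsMinGenSyz f 3 ![d1, d2, d3] v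

/-- `C : f = 0` of degree `d` is a plus-one generated curve. -/
def IsPOG (f : S3) (d : ℕ) : Prop := ∃ d1 d2 d3, IsPOGWith f d d1 d2 d3

/-- `C : f = 0` of degree `d` is minimal plus-one generated (MPOG),
with exponents `(d1, d2, d2 + 1)`. -/
def IsMPOGWith (f : S3) (d d1 d2 : ℕ) : Prop := IsPOGWith f d d1 d2 (d2 + 1)

/-- `C : f = 0` of degree `d` is an MPOG-curve. -/
def IsMPOG (f : S3) (d : ℕ) : Prop := ∃ d1 d2, IsMPOGWith f d d1 d2

/-- `r = mdr(f)`: the minimal degree of a nonzero (homogeneous) Jacobian relation for `f`. -/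
def IsMDR (f : S3) (r : ℕ) : Prop :=
  (∃ v ∈ jacSyz f, v ≠ 0 ∧ ∀ i, (v i).IsHomogeneous r) ∧
  ∀ m, m < r → ∀ v ∈ jacSyz f, (∀ i, (v i).IsHomogeneous m) → v = 0

/-- The Jacobian ideal `J_f` of `f`. -/
def jacobianIdeal (f : S3) : Ideal S3 := Ideal.span {pderiv 0 f, pderiv 1 f, pderiv 2 f}

/-- The dimension of the degree `k` graded piece of the Milnor algebra `M(f) = S/J_f`. -/
def milnorDim (f : S3) (k : ℕ) : ℕ :=
  Module.finrank ℂ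
    (↥(homogeneousSubmodule (Fin 3) ℂ k) ⧸
      (Submodule.comap (homogeneousSubmodule (Fin 3) ℂ k).subtype
        (Submodule.restrictScalars ℂ (jacobianIdeal f))))

/-- `τ` is the total Tjurina number of the reduced curve `C : f = 0`, i.e. the degree of the
Jacobian ideal `J_f`: for all large `k` one has `dim M(f)_k = τ`. -/
def IsTjurina (f : S3) (τ : ℕ) : Prop := ∀ᶠ k in Filter.atTop, milnorDim f k = τ

/-- `C : f = 0` is a maximal Tjurina curve of type `(d, r)`. -/
def IsMaxTjurina (f : S3) (d r : ℕ) : Prop :=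
  IsMDR f r ∧ d ≤ 2 * r ∧
  ∃ τ : ℕ, IsTjurina f τ ∧
    (τ : ℤ) = ((d : ℤ) - 1) ^ 2 - r * ((d : ℤ) - r - 1) - (Nat.choose (2 * r + 2 - d) 2 : ℤ)

/-- `f` is a product of `d` linear forms all vanishing at a common point, i.e.
`C : f = 0` is the union of `d` lines passing through one point. -/
def IsUnionOfConcurrentLines (f : S3) (d : ℕ) : Prop :=
  ∃ (c : ℂ) (L : Fin d → Fin 3 → ℂ) (v : Fin 3 → ℂ), v ≠ 0 ∧
    f = C c * ∏ j, (∑ i, C (L j i) * X i) ∧ ∀ j, (∑ i, L j i * v i) = 0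

/-- The ideal `I_θ` generated by the 2×2 minors of the matrix with rows `(x,y,z)` and
`(a,b,c)`, defining the eigenscheme `Γ_θ` of the derivation `θ = a ∂_x + b ∂_y + c ∂_z`. -/
def eigenIdeal (a b c : S3) : Ideal S3 :=
  Ideal.span {X 1 * c - X 2 * b, X 2 * a - X 0 * c, X 0 * b - X 1 * a}

/-- The projective plane `ℙ²(ℂ)`. -/
abbrev Pt := Projectivization ℂ (Fin 3 → ℂ)

/-- The eigenscheme `Γ_θ` of `θ = a ∂_x + b ∂_y + c ∂_z` is 0-dimensional:
its set of points in `ℙ²` is finite. -/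
def EigenSchemeFinite (a b c : S3) : Prop :=
  {p : Pt | eval p.rep (X 1 * c - X 2 * b) = 0 ∧ eval p.rep (X 2 * a - X 0 * c) = 0 ∧
      eval p.rep (X 0 * b - X 1 * a) = 0}.Finite

/-- The homogenization `f₀` of the Briançon polynomial `g`. -/
def f0 : S3 :=
  X 0 ^ 6 * X 1 ^ 4 + 4 * X 0 ^ 5 * X 1 ^ 3 * X 2 ^ 2 + 3 * X 0 ^ 4 * X 1 ^ 3 * X 2 ^ 3 +
    6 * X 0 ^ 4 * X 1 ^ 2 * X 2 ^ 4 + C (19 / 3 : ℂ) * X 0 ^ 3 * X 1 ^ 2 * X 2 ^ 5 +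
    4 * X 0 ^ 3 * X 1 * X 2 ^ 6 + 3 * X 0 ^ 2 * X 1 ^ 2 * X 2 ^ 6 +
    C (11 / 3 : ℂ) * X 0 ^ 2 * X 1 * X 2 ^ 7 + X 0 ^ 2 * X 2 ^ 8 + 2 * X 0 * X 1 * X 2 ^ 8 +
    C (1 / 3 : ℂ) * X 0 * X 2 ^ 9 + X 1 * X 2 ^ 9 - X 2 ^ 10

/-- `f_b = f₀ + (16/9) z¹⁰`. -/
def fb : S3 := f0 + C (16 / 9 : ℂ) * X 2 ^ 10

/-- `f₁ = f₀ - z¹⁰`. -/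
def f1 : S3 := f0 - X 2 ^ 10

/-- The homogenization `f'₀` of the Briançon-type polynomial `g'`. -/
def f0' : S3 :=
  X 0 ^ 6 * X 1 ^ 4 + 4 * X 0 ^ 5 * X 1 ^ 3 * X 2 ^ 2 + 3 * X 0 ^ 4 * X 1 ^ 3 * X 2 ^ 3 +
    6 * X 0 ^ 4 * X 1 ^ 2 * X 2 ^ 4 + C (65 / 9 : ℂ) * X 0 ^ 3 * X 1 ^ 2 * X 2 ^ 5 +
    4 * X 0 ^ 3 * X 1 * X 2 ^ 6 + 3 * X 0 ^ 2 * X 1 ^ 2 * X 2 ^ 6 +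
    C (49 / 9 : ℂ) * X 0 ^ 2 * X 1 * X 2 ^ 7 + X 0 ^ 2 * X 2 ^ 8 +
    C (10 / 3 : ℂ) * X 0 * X 1 * X 2 ^ 8 + C (11 / 9 : ℂ) * X 0 * X 2 ^ 9 + X 1 * X 2 ^ 9 +
    C (1 / 3 : ℂ) * X 2 ^ 10

/-- `f'_{b'} = f'₀ + (64/81) z¹⁰`. -/
def fb' : S3 := f0' + C (64 / 81 : ℂ) * X 2 ^ 10

/-- `f'₁ = f'₀ - z¹⁰`. -/
def f1' : S3 := f0' - X 2 ^ 10

/-! ### Exactness of a length-two complex `S² → S⁴ → S³ → S` -/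

/-- The cross product of `a` and `b`, with cyclic indexing of the coordinates. -/
def wedge (a b : Fin 3 → S3) (l : Fin 3) : S3 := a (l + 1) * b (l + 2) - a (l + 2) * b (l + 1)

/-- The `2 × 2` minor on rows `i`, `j` of the matrix with columns `p`, `q`. -/
def minorTwo (p q : Fin 4 → S3) (i j : Fin 4) : S3 := p i * q j - p j * q i

/-- The ideal of `2 × 2` minors of the `4 × 2` matrix with columns `p`, `q`. -/
def minorIdeal (p q : Fin 4 → S3) : Ideal S3 :=
  Ideal.span (Set.range fun ij : Fin 4 × Fin 4 => minorTwo p q ij.1 ij.2)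

/-- The `3 × 3` minor on rows `i`, `j`, `k` of the matrix with columns `a`, `p`, `q`. -/
def minorThree (a p q : Fin 4 → S3) (i j k : Fin 4) : S3 :=
  a i * minorTwo p q j k - a j * minorTwo p q i k + a k * minorTwo p q i j

/-- A complex `S² → S⁴ → S³ → S` with maps `(p, q)`, `v` and `g`, whose first map has minors
defining the irrelevant ideal up to radical, and in which the cross product of the first two
vectors `v 0`, `v 1` is the complementary minor of `(p, q)` times `g`. -/
structure IsSyzComplex (g : Fin 3 → S3) (v : Fin 4 → Fin 3 → S3) (p q : Fin 4 → S3) : Prop where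
  syz : ∀ j, v j 0 * g 0 + v j 1 * g 1 + v j 2 * g 2 = 0
  rel_left : ∀ l, p 0 * v 0 l + p 1 * v 1 l + p 2 * v 2 l + p 3 * v 3 l = 0
  rel_right : ∀ l, q 0 * v 0 l + q 1 * v 1 l + q 2 * v 2 l + q 3 * v 3 l = 0
  minor_ne : minorTwo p q 2 3 ≠ 0
  wedge_eq : ∀ l, wedge (v 0) (v 1) l = minorTwo p q 2 3 * g l
  sq_mem : ∀ k, (X k : S3) ^ 2 ∈ minorIdeal p q
  not_dvd : ∀ k, ∃ l, ¬ (X k : S3) ∣ g l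

/-- A linear combination of the four vectors `v j`. -/
def comb (v : Fin 4 → Fin 3 → S3) (a : Fin 4 → S3) (l : Fin 3) : S3 :=
  a 0 * v 0 l + a 1 * v 1 l + a 2 * v 2 l + a 3 * v 3 l

theorem mem_span_range_iff_comb {v : Fin 4 → Fin 3 → S3} {w : Fin 3 → S3} :
    w ∈ Submodule.span S3 (Set.range v) ↔ ∃ a, comb v a = w := by
  rw [Submodule.mem_span_range_iff_exists_fun]
  refine exists_congr fun a => ?_
  rw [Fin.sum_univ_four]
  rfl

theorem minorTwo_mem (p q : Fin 4 → S3) (i j : Fin 4) : minorTwo p q i j ∈ minorIdeal p q :=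
  Ideal.subset_span ⟨(i, j), rfl⟩

theorem dvd_minorThree_of_ordered {a p q : Fin 4 → S3} {t : S3}
    (h012 : t ∣ minorThree a p q 0 1 2) (h013 : t ∣ minorThree a p q 0 1 3)
    (h023 : t ∣ minorThree a p q 0 2 3) (h123 : t ∣ minorThree a p q 1 2 3) (i j k : Fin 4) :
    t ∣ minorThree a p q i j k := by
  have s12 : ∀ i j k, minorThree a p q j i k = -minorThree a p q i j k := by
    intros; simp only [minorThree, minorTwo]; ring
  have s23 : ∀ i j k, minorThree a p q i k j = -minorThree a p q i j k := by
    intros; simp only [minorThree, minorTwo]; ring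
  have e12 : ∀ i k, minorThree a p q i i k = 0 := by
    intros; simp only [minorThree, minorTwo]; ring
  have e23 : ∀ i k, minorThree a p q i k k = 0 := by
    intros; simp only [minorThree, minorTwo]; ring
  have e13 : ∀ i k, minorThree a p q i k i = 0 := by
    intros; simp only [minorThree, minorTwo]; ring
  have d12 : ∀ i j k, t ∣ minorThree a p q j i k ↔ t ∣ minorThree a p q i j k := by
    intros; rw [s12, dvd_neg]
  have d23 : ∀ i j k, t ∣ minorThree a p q i k j ↔ t ∣ minorThree a p q i j k := by
    intros; rw [s23, dvd_neg]
  have sorted : ∀ i j k, i < j → j < k → t ∣ minorThree a p q i j k := by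
    intro i j k hij hjk
    have cases : ∀ i j k : Fin 4, i < j → j < k → (i = 0 ∧ j = 1 ∧ k = 2) ∨
        (i = 0 ∧ j = 1 ∧ k = 3) ∨ (i = 0 ∧ j = 2 ∧ k = 3) ∨ (i = 1 ∧ j = 2 ∧ k = 3) := by decide
    rcases cases i j k hij hjk with ⟨rfl, rfl, rfl⟩ | ⟨rfl, rfl, rfl⟩ | ⟨rfl, rfl, rfl⟩ |
      ⟨rfl, rfl, rfl⟩
    exacts [h012, h013, h023, h123]
  rcases lt_trichotomy i j with hij | rfl | hij
  · rcases lt_trichotomy j k with hjk | rfl | hjk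
    · exact sorted _ _ _ hij hjk
    · simp [e23]
    · rw [d23]
      rcases lt_trichotomy i k with hik | rfl | hik
      · exact sorted _ _ _ hik hjk
      · simp [e12]
      · rw [d12]; exact sorted _ _ _ hik hij
  · simp [e12]
  · rw [d12]
    rcases lt_trichotomy i k with hik | rfl | hik
    · exact sorted _ _ _ hij hik
    · simp [e23]
    · rw [d23]
      rcases lt_trichotomy j k with hjk | rfl | hjk
      · exact sorted _ _ _ hjk hik
      · simp [e12]
      · rw [d12]; exact sorted _ _ _ hjk hij

namespace IsSyzComplex

variable {g : Fin 3 → S3} {v : Fin 4 → Fin 3 → S3} {p q : Fin 4 → S3}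

theorem wedge_zero_two (h : IsSyzComplex g v p q) (l : Fin 3) :
    wedge (v 0) (v 2) l = -minorTwo p q 1 3 * g l := by
  refine mul_left_cancel₀ h.minor_ne ?_
  have h01 := h.wedge_eq l
  simp only [wedge, minorTwo] at *
  linear_combination -(p 1 * q 3 - p 3 * q 1) * h01 +
    v 0 (l + 1) * (q 3 * h.rel_left (l + 2) - p 3 * h.rel_right (l + 2)) -
    v 0 (l + 2) * (q 3 * h.rel_left (l + 1) - p 3 * h.rel_right (l + 1))

theorem wedge_one_two (h : IsSyzComplex g v p q) (l : Fin 3) :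
    wedge (v 1) (v 2) l = minorTwo p q 0 3 * g l := by
  refine mul_left_cancel₀ h.minor_ne ?_
  have h01 := h.wedge_eq l
  simp only [wedge, minorTwo] at *
  linear_combination (p 0 * q 3 - p 3 * q 0) * h01 +
    v 1 (l + 1) * (q 3 * h.rel_left (l + 2) - p 3 * h.rel_right (l + 2)) -
    v 1 (l + 2) * (q 3 * h.rel_left (l + 1) - p 3 * h.rel_right (l + 1))

theorem wedge_zero_three (h : IsSyzComplex g v p q) (l : Fin 3) :
    wedge (v 0) (v 3) l = minorTwo p q 1 2 * g l := by
  refine mul_left_cancel₀ h.minor_ne ?_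
  have h01 := h.wedge_eq l
  simp only [wedge, minorTwo] at *
  linear_combination (p 1 * q 2 - p 2 * q 1) * h01 -
    v 0 (l + 1) * (q 2 * h.rel_left (l + 2) - p 2 * h.rel_right (l + 2)) +
    v 0 (l + 2) * (q 2 * h.rel_left (l + 1) - p 2 * h.rel_right (l + 1))

theorem wedge_one_three (h : IsSyzComplex g v p q) (l : Fin 3) :
    wedge (v 1) (v 3) l = -minorTwo p q 0 2 * g l := by
  refine mul_left_cancel₀ h.minor_ne ?_
  have h01 := h.wedge_eq l
  simp only [wedge, minorTwo] at *
  linear_combination -(p 0 * q 2 - p 2 * q 0) * h01 -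
    v 1 (l + 1) * (q 2 * h.rel_left (l + 2) - p 2 * h.rel_right (l + 2)) +
    v 1 (l + 2) * (q 2 * h.rel_left (l + 1) - p 2 * h.rel_right (l + 1))

theorem wedge_two_three (h : IsSyzComplex g v p q) (l : Fin 3) :
    wedge (v 2) (v 3) l = minorTwo p q 0 1 * g l := by
  refine mul_left_cancel₀ h.minor_ne ?_
  have h02 := h.wedge_zero_two l
  have h12 := h.wedge_one_two l
  simp only [wedge, minorTwo] at *
  linear_combination -(p 0 * q 2 - p 2 * q 0) * h02 - (p 1 * q 2 - p 2 * q 1) * h12 -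
    v 2 (l + 1) * (q 2 * h.rel_left (l + 2) - p 2 * h.rel_right (l + 2)) +
    v 2 (l + 2) * (q 2 * h.rel_left (l + 1) - p 2 * h.rel_right (l + 1))

/-- Every minor of `(p, q)` times `g` is, up to sign, a cross product of two of the `v j`. -/
theorem exists_wedge_eq (h : IsSyzComplex g v p q) (i j : Fin 4) :
    ∃ a b, ∀ l, minorTwo p q i j * g l = wedge (v a) (v b) l := by
  have swap : ∀ a b l, wedge (v a) (v b) l = -wedge (v b) (v a) l := by
    intro a b l; simp only [wedge]; ring
  have self : ∀ a l, wedge (v a) (v a) l = 0 := by intro a l; simp only [wedge]; ring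
  have h01 := h.wedge_eq
  have h02 := h.wedge_zero_two
  have h03 := h.wedge_zero_three
  have h12 := h.wedge_one_two
  have h13 := h.wedge_one_three
  have h23 := h.wedge_two_three
  have ordered : ∀ i j, i < j → ∃ a b, ∀ l, minorTwo p q i j * g l = wedge (v a) (v b) l := by
    intro i j hij
    have cases : ∀ i j : Fin 4, i < j → (i = 0 ∧ j = 1) ∨ (i = 0 ∧ j = 2) ∨ (i = 0 ∧ j = 3) ∨
        (i = 1 ∧ j = 2) ∨ (i = 1 ∧ j = 3) ∨ (i = 2 ∧ j = 3) := by decide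
    rcases cases i j hij with ⟨rfl, rfl⟩ | ⟨rfl, rfl⟩ | ⟨rfl, rfl⟩ | ⟨rfl, rfl⟩ | ⟨rfl, rfl⟩ |
      ⟨rfl, rfl⟩
    · exact ⟨2, 3, fun l => by rw [h23]⟩
    · exact ⟨3, 1, fun l => by rw [swap, h13]; ring⟩
    · exact ⟨1, 2, fun l => by rw [h12]⟩
    · exact ⟨0, 3, fun l => by rw [h03]⟩
    · exact ⟨2, 0, fun l => by rw [swap, h02]; ring⟩
    · exact ⟨0, 1, fun l => by rw [h01]⟩
  rcases lt_trichotomy i j with hij | rfl | hij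
  · exact ordered i j hij
  · exact ⟨0, 0, fun l => by simp only [self, minorTwo]; ring⟩
  · obtain ⟨a, b, hab⟩ := ordered j i hij
    refine ⟨b, a, fun l => ?_⟩
    rw [swap, ← hab]
    simp only [minorTwo]; ring

/-- If a combination of the `v j` vanishes modulo `t`, so do the `3 × 3` minors of `(a, p, q)`. -/
theorem dvd_minorThree (h : IsSyzComplex g v p q) {t : S3}
    (hg : ∀ u, (∀ l, t ∣ u * g l) → t ∣ u) {a : Fin 4 → S3} (ha : ∀ l, t ∣ comb v a l)
    (i j k : Fin 4) : t ∣ minorThree a p q i j k := by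
  have hw : ∀ b l, t ∣ wedge (comb v a) (v b) l := fun b l =>
    dvd_sub ((ha _).mul_right _) ((ha _).mul_right _)
  have swap : ∀ a b l, wedge (v a) (v b) l = -wedge (v b) (v a) l := by
    intro a b l; simp only [wedge]; ring
  have expand : ∀ b l, wedge (comb v a) (v b) l = a 0 * wedge (v 0) (v b) l +
      a 1 * wedge (v 1) (v b) l + a 2 * wedge (v 2) (v b) l + a 3 * wedge (v 3) (v b) l := by
    intro b l; simp only [wedge, comb]; ring
  have self : ∀ a l, wedge (v a) (v a) l = 0 := by intro a l; simp only [wedge]; ring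
  have h012 : t ∣ minorThree a p q 0 1 2 := hg _ fun l => by
    convert hw 3 l using 1
    rw [expand, h.wedge_zero_three, h.wedge_one_three, h.wedge_two_three, self]
    simp only [minorThree]; ring
  have h013 : t ∣ minorThree a p q 0 1 3 := hg _ fun l => by
    rw [← dvd_neg]
    convert hw 2 l using 1
    rw [expand, h.wedge_zero_two, h.wedge_one_two, self, swap 3, h.wedge_two_three]
    simp only [minorThree]; ring
  have h023 : t ∣ minorThree a p q 0 2 3 := hg _ fun l => by
    convert hw 1 l using 1
    rw [expand, h.wedge_eq, self, swap 2, swap 3, h.wedge_one_two, h.wedge_one_three]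
    simp only [minorThree]; ring
  have h123 : t ∣ minorThree a p q 1 2 3 := hg _ fun l => by
    rw [← dvd_neg]
    convert hw 0 l using 1
    rw [expand, self, swap 1, swap 2, swap 3, h.wedge_eq, h.wedge_zero_two, h.wedge_zero_three]
    simp only [minorThree]; ring
  exact dvd_minorThree_of_ordered h012 h013 h023 h123 i j k

/-- Exactness of `S² → S⁴ → S³` modulo `t`, for `t` such that `s`, `r` is a regular sequence
modulo `t` contained in the ideal of minors of `(p, q)`. -/
theorem exists_relation_mod (h : IsSyzComplex g v p q) {t s r : S3}
    (hg : ∀ u, (∀ l, t ∣ u * g l) → t ∣ u) (hs : s ∈ minorIdeal p q) (hr : r ∈ minorIdeal p q)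
    (hts : ∀ u, t ∣ s * u → t ∣ u)
    (htr : ∀ c d, t ∣ r * c - s * d → ∃ c', t ∣ c - s * c')
    {a : Fin 4 → S3} (ha : ∀ l, t ∣ comb v a l) :
    ∃ c d, ∀ j, t ∣ a j - (p j * c + q j * d) := by
  have key : ∀ x ∈ minorIdeal p q, ∃ c d, ∀ j, t ∣ x * a j - (p j * c + q j * d) := by
    intro x hx
    induction hx using Submodule.span_induction with
    | mem x hx =>
      obtain ⟨⟨i, k⟩, rfl⟩ := hx
      refine ⟨a i * q k - a k * q i, p i * a k - p k * a i, fun j => ?_⟩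
      convert h.dvd_minorThree hg ha i k j using 1
      simp only [minorThree, minorTwo]; ring
    | zero => exact ⟨0, 0, fun j => by simp⟩
    | add x y _ _ hx hy =>
      obtain ⟨c, d, hx⟩ := hx
      obtain ⟨c', d', hy⟩ := hy
      refine ⟨c + c', d + d', fun j => ?_⟩
      convert dvd_add (hx j) (hy j) using 1; ring
    | smul y x _ hx =>
      obtain ⟨c, d, hx⟩ := hx
      refine ⟨y * c, y * d, fun j => ?_⟩
      convert (hx j).mul_left y using 1; rw [smul_eq_mul]; ring
  have inj : ∀ c d, (∀ j, t ∣ p j * c + q j * d) → t ∣ c ∧ t ∣ d := by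
    intro c d hcd
    have hx : ∀ x ∈ minorIdeal p q, t ∣ x * c ∧ t ∣ x * d := by
      intro x hx
      induction hx using Submodule.span_induction with
      | mem x hx =>
        obtain ⟨⟨i, k⟩, rfl⟩ := hx
        constructor
        · convert dvd_sub ((hcd i).mul_left (q k)) ((hcd k).mul_left (q i)) using 1
          simp only [minorTwo]; ring
        · convert dvd_sub ((hcd k).mul_left (p i)) ((hcd i).mul_left (p k)) using 1
          simp only [minorTwo]; ring
      | zero => simp
      | add x y _ _ hx hy =>
        rw [add_mul, add_mul]
        exact ⟨dvd_add hx.1 hy.1, dvd_add hx.2 hy.2⟩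
      | smul y x _ hx =>
        rw [smul_eq_mul, mul_assoc, mul_assoc]
        exact ⟨hx.1.mul_left _, hx.2.mul_left _⟩
    exact ⟨hts _ (hx s hs).1, hts _ (hx s hs).2⟩
  obtain ⟨c, d, hcd⟩ := key s hs
  obtain ⟨c', d', hcd'⟩ := key r hr
  obtain ⟨hC, hD⟩ := inj (r * c - s * c') (r * d - s * d') fun j => by
    convert dvd_sub ((hcd' j).mul_left s) ((hcd j).mul_left r) using 1; ring
  obtain ⟨e, he⟩ := htr _ _ hC
  obtain ⟨e', he'⟩ := htr _ _ hD
  refine ⟨e, e', fun j => hts _ ?_⟩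
  convert dvd_add (hcd j) (dvd_add (he.mul_left (p j)) (he'.mul_left (q j))) using 1
  ring

end IsSyzComplex

/-- The substitution `X k ↦ 0`. -/
def killVar (k : Fin 3) : S3 →ₐ[ℂ] S3 := aeval fun i => if i = k then 0 else X i

theorem X_dvd_sub_killVar (k : Fin 3) (u : S3) : X k ∣ u - killVar k u := by
  induction u using MvPolynomial.induction_on with
  | C a => simp [killVar]
  | add u w hu hw => rw [map_add, add_sub_add_comm]; exact dvd_add hu hw
  | mul_X u i hu =>
    rw [map_mul]
    by_cases hi : i = k
    · subst hi; simp [killVar]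
    · have : killVar k (X i) = X i := by simp [killVar, hi]
      rw [this, ← sub_mul]; exact hu.mul_right _

theorem X_dvd_iff_killVar {k : Fin 3} {u : S3} : X k ∣ u ↔ killVar k u = 0 := by
  constructor
  · rintro ⟨w, rfl⟩; simp [killVar]
  · intro h; simpa [h] using X_dvd_sub_killVar k u

theorem not_X_dvd_X_sq {i j : Fin 3} (hij : i ≠ j) : ¬ (X i : S3) ∣ X j ^ 2 := by
  rw [X_dvd_iff_killVar]
  simp [killVar, hij.symm]

/-- `X i ^ 2`, `X j ^ 2` is a regular sequence. -/
theorem X_sq_dvd_of_mul_eq {i j : Fin 3} (hij : i ≠ j) {c d : S3}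
    (h : X j ^ 2 * c = X i ^ 2 * d) : (X i : S3) ^ 2 ∣ c :=
  (X_prime (R := ℂ)).pow_dvd_of_dvd_mul_left 2 (not_X_dvd_X_sq hij) ⟨d, h⟩

namespace IsSyzComplex

variable {g : Fin 3 → S3} {v : Fin 4 → Fin 3 → S3} {p q : Fin 4 → S3}

/-- Exactness of `S² → S⁴ → S³`. -/
theorem exists_relation (h : IsSyzComplex g v p q) {a : Fin 4 → S3} (ha : comb v a = 0) :
    ∃ c d, ∀ j, a j = p j * c + q j * d := by
  have := h.exists_relation_mod (t := 0) (s := X 0 ^ 2) (r := X 1 ^ 2) (a := a) ?_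
    (h.sq_mem 0) (h.sq_mem 1) ?_ ?_ (by simp [ha])
  · simpa only [zero_dvd_iff, sub_eq_zero] using this
  · intro u hu
    obtain ⟨l, hl⟩ := h.not_dvd 0
    have hl0 : g l ≠ 0 := fun h0 => hl (h0 ▸ dvd_zero _)
    have := hu l
    rw [zero_dvd_iff, mul_eq_zero] at this
    simpa [hl0] using this
  · intro u hu
    simpa using hu
  · intro c d hcd
    rw [zero_dvd_iff, sub_eq_zero] at hcd
    obtain ⟨c', hc'⟩ := X_sq_dvd_of_mul_eq (by decide : (0 : Fin 3) ≠ 1) hcd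
    exact ⟨c', by simp [hc']⟩

/-- Variables are nonzerodivisors on the cokernel of `v`. -/
theorem mem_of_X_smul_mem (h : IsSyzComplex g v p q) (k : Fin 3) {u : Fin 3 → S3}
    (hu : (X k : S3) • u ∈ Submodule.span S3 (Set.range v)) :
    u ∈ Submodule.span S3 (Set.range v) := by
  rw [mem_span_range_iff_comb] at hu ⊢
  obtain ⟨a, ha⟩ := hu
  have others : ∀ k : Fin 3, ∃ i j : Fin 3, i ≠ k ∧ j ≠ k ∧ i ≠ j := by decide
  obtain ⟨i, j, hik, hjk, hij⟩ := others k
  have hX : Prime (X k : S3) := X_prime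
  obtain ⟨c, d, hcd⟩ := h.exists_relation_mod (t := X k) (s := X i ^ 2) (r := X j ^ 2) (a := a)
    (by
      intro w hw
      obtain ⟨l, hl⟩ := h.not_dvd k
      exact (hX.dvd_or_dvd (hw l)).resolve_right hl)
    (h.sq_mem i) (h.sq_mem j)
    (fun w hw => (hX.dvd_or_dvd hw).resolve_left (not_X_dvd_X_sq hik.symm))
    (by
      intro c d hcd
      rw [X_dvd_iff_killVar, map_sub, sub_eq_zero, map_mul, map_mul] at hcd
      have hi : killVar k (X i ^ 2) = X i ^ 2 := by simp [killVar, hik]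
      have hj : killVar k (X j ^ 2) = X j ^ 2 := by simp [killVar, hjk]
      rw [hi, hj] at hcd
      obtain ⟨c', hc'⟩ := X_sq_dvd_of_mul_eq hij hcd
      exact ⟨c', hc' ▸ X_dvd_sub_killVar k c⟩)
    (fun l => by rw [ha]; exact ⟨u l, rfl⟩)
  choose b hb using hcd
  refine ⟨b, funext fun l => mul_left_cancel₀ hX.ne_zero ?_⟩
  have hl := congrFun ha l
  simp only [Pi.smul_apply, smul_eq_mul, comb] at hl ⊢
  linear_combination hl - v 0 l * hb 0 - v 1 l * hb 1 - v 2 l * hb 2 - v 3 l * hb 3 -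
    c * h.rel_left l - d * h.rel_right l

theorem mem_of_X_pow_smul_mem (h : IsSyzComplex g v p q) (k : Fin 3) (n : ℕ) {u : Fin 3 → S3}
    (hu : (X k : S3) ^ n • u ∈ Submodule.span S3 (Set.range v)) :
    u ∈ Submodule.span S3 (Set.range v) := by
  induction n with
  | zero => simpa using hu
  | succ n ih => exact ih (h.mem_of_X_smul_mem k (by rwa [smul_smul, ← pow_succ']))

theorem minorTwo_mul_smul_mem (h : IsSyzComplex g v p q) {w : Fin 3 → S3}
    (hw : w 0 * g 0 + w 1 * g 1 + w 2 * g 2 = 0) (i j : Fin 4) (l : Fin 3) :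
    (minorTwo p q i j * g l) • w ∈ Submodule.span S3 (Set.range v) := by
  obtain ⟨a, b, hab⟩ := h.exists_wedge_eq i j
  have hdet : w 0 * wedge (v a) (v b) 0 + w 1 * wedge (v a) (v b) 1 +
      w 2 * wedge (v a) (v b) 2 = 0 := by
    rw [← hab, ← hab, ← hab]; linear_combination minorTwo p q i j * hw
  have : (minorTwo p q i j * g l) • w = wedge w (v b) l • v a + wedge (v a) w l • v b := by
    rw [hab]
    funext m
    simp only [Pi.smul_apply, Pi.add_apply, smul_eq_mul]
    simp only [wedge, Fin.isValue, Fin.reduceAdd, zero_add] at hdet ⊢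
    fin_cases l <;> fin_cases m <;>
      simp only [Fin.zero_eta, Fin.mk_one, Fin.reduceFinMk, Fin.isValue, Fin.reduceAdd, zero_add] <;>
      first
      | ring1
      | linear_combination hdet
  rw [this]
  exact add_mem (Submodule.smul_mem _ _ (Submodule.subset_span ⟨a, rfl⟩))
    (Submodule.smul_mem _ _ (Submodule.subset_span ⟨b, rfl⟩))

/-- If the ideal generated by `g` contains a monomial, then the complex is exact at `S³`. -/
theorem mem_span (h : IsSyzComplex g v p q) {i j k : ℕ}
    (hJ : (X 0 : S3) ^ i * X 1 ^ j * X 2 ^ k ∈ Ideal.span (Set.range g)) {w : Fin 3 → S3}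
    (hw : w 0 * g 0 + w 1 * g 1 + w 2 * g 2 = 0) : w ∈ Submodule.span S3 (Set.range v) := by
  have step : ∀ x ∈ Ideal.span (Set.range g), ∀ y ∈ minorIdeal p q,
      (y * x) • w ∈ Submodule.span S3 (Set.range v) := by
    intro x hx
    induction hx using Submodule.span_induction with
    | mem x hx =>
      obtain ⟨l, rfl⟩ := hx
      intro y hy
      induction hy using Submodule.span_induction with
      | mem y hy =>
        obtain ⟨⟨a, b⟩, rfl⟩ := hy
        exact h.minorTwo_mul_smul_mem hw a b l
      | zero => simp
      | add y z _ _ hy hz => rw [add_mul, add_smul]; exact add_mem hy hz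
      | smul c y _ hy =>
        rw [smul_eq_mul, mul_assoc, mul_smul]; exact Submodule.smul_mem _ _ hy
    | zero => simp
    | add x z _ _ hx hz =>
      intro y hy
      rw [mul_add, add_smul]; exact add_mem (hx y hy) (hz y hy)
    | smul c x _ hx =>
      intro y hy
      rw [smul_eq_mul, mul_left_comm, mul_smul]; exact Submodule.smul_mem _ _ (hx y hy)
  have := step _ hJ _ (h.sq_mem 0)
  rw [show (X 0 : S3) ^ 2 * (X 0 ^ i * X 1 ^ j * X 2 ^ k) =
    X 0 ^ (i + 2) * (X 1 ^ j * X 2 ^ k) by ring, mul_smul, mul_smul] at this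
  exact h.mem_of_X_pow_smul_mem 2 k (h.mem_of_X_pow_smul_mem 1 j
    (h.mem_of_X_pow_smul_mem 0 (i + 2) this))

end IsSyzComplex

/-! ### Graded pieces and Hilbert functions -/

theorem homogeneousComponent_mul_of_isHomogeneous {a b : S3} {e k : ℕ} (hb : b.IsHomogeneous e) :
    homogeneousComponent (k + e) (a * b) = homogeneousComponent k a * b := by
  conv_lhs => rw [← sum_homogeneousComponent a, Finset.sum_mul, map_sum]
  have term : ∀ i, homogeneousComponent (k + e) (homogeneousComponent i a * b) =
      if i = k then homogeneousComponent i a * b else 0 := by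
    intro i
    rw [homogeneousComponent_of_mem ((homogeneousComponent_isHomogeneous i a).mul hb)]
    simp [eq_comm]
  rw [Finset.sum_congr rfl fun i _ => term i, Finset.sum_ite_eq']
  split_ifs with h
  · rfl
  · rw [homogeneousComponent_eq_zero _ _ (by simpa using h), zero_mul]

theorem homogeneousComponent_mul_of_lt {a b : S3} {e k : ℕ} (hb : b.IsHomogeneous e)
    (h : k < e) : homogeneousComponent k (a * b) = 0 := by
  rw [← sum_homogeneousComponent a, Finset.sum_mul, map_sum]
  refine Finset.sum_eq_zero fun i _ => ?_
  rw [homogeneousComponent_of_mem ((homogeneousComponent_isHomogeneous i a).mul hb),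
    if_neg (by omega)]

theorem two_mul_finrank_homogeneousSubmodule (n : ℕ) :
    2 * Module.finrank ℂ (homogeneousSubmodule (Fin 3) ℂ n) = (n + 2) * (n + 1) := by
  have hset : {d : Fin 3 →₀ ℕ | d.degree = n} =
      ((Finset.univ.finsuppAntidiag n : Finset (Fin 3 →₀ ℕ)) : Set (Fin 3 →₀ ℕ)) := by
    ext d
    simp [Finset.mem_finsuppAntidiag, Finsupp.degree_eq_sum]
  rw [homogeneousSubmodule_eq_finsupp_supported, hset,
    (AddMonoidAlgebra.supportedEquivFinsupp _).finrank_eq, Module.finrank_finsupp_self]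
  simp only [Finset.coe_sort_coe, Fintype.card_coe]
  rw [Finset.card_finsuppAntidiag_nat_eq_choose]
  rw [Finset.card_univ, Fintype.card_fin, show 3 + n - 1 = n + 2 by omega, Nat.choose_symm_add,
    Nat.choose_two_right, Nat.add_sub_assoc (by omega)]
  exact Nat.mul_div_cancel' (even_iff_two_dvd.1 (by simpa [mul_comm] using Nat.even_mul_succ_self (n + 1)))

instance finite_homogeneousSubmodule (n : ℕ) :
    Module.Finite ℂ (homogeneousSubmodule (Fin 3) ℂ n) :=
  Module.Finite.iff_fg.2 (homogeneousSubmodule_fg (Fin 3) ℂ n)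

/-- Tuples of forms of degree `k`. -/
def formTuples (n k : ℕ) : Submodule ℂ (Fin n → S3) :=
  Submodule.pi Set.univ fun _ => homogeneousSubmodule (Fin 3) ℂ k

theorem mem_formTuples {n k : ℕ} {a : Fin n → S3} :
    a ∈ formTuples n k ↔ ∀ j, (a j).IsHomogeneous k := by
  simp [formTuples]

theorem formTuples_eq_range (n k : ℕ) : formTuples n k =
    LinearMap.range ((homogeneousSubmodule (Fin 3) ℂ k).subtype.compLeft (Fin n)) := by
  ext a
  rw [mem_formTuples]
  constructor
  · intro h
    exact ⟨fun j => ⟨a j, h j⟩, rfl⟩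
  · rintro ⟨b, rfl⟩ j
    exact (b j).2

instance finite_formTuples (n k : ℕ) : Module.Finite ℂ (formTuples n k) := by
  rw [formTuples_eq_range]; infer_instance

theorem finrank_formTuples (n k : ℕ) : Module.finrank ℂ (formTuples n k) =
    n * Module.finrank ℂ (homogeneousSubmodule (Fin 3) ℂ k) := by
  rw [formTuples_eq_range, LinearMap.finrank_range_of_inj]
  · rw [Module.finrank_pi_fintype, Finset.sum_const, Finset.card_univ, Fintype.card_fin,
      smul_eq_mul]
  · intro a b hab
    funext j
    exact Subtype.ext (congrFun hab j)

/-- The map `Sⁿ → Sᵐ` sending the `j`-th basis vector to `A j`, over the base field. -/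
def combMap {n m : ℕ} (A : Fin n → Fin m → S3) : (Fin n → S3) →ₗ[ℂ] (Fin m → S3) :=
  (Fintype.linearCombination S3 A).restrictScalars ℂ

theorem combMap_apply {n m : ℕ} (A : Fin n → Fin m → S3) (a : Fin n → S3) (l : Fin m) :
    combMap A a l = ∑ j, a j * A j l := by
  simp [combMap, Fintype.linearCombination_apply]

theorem map_combMap_formTuples {n m e : ℕ} {A : Fin n → Fin m → S3}
    (hA : ∀ j l, (A j l).IsHomogeneous e) (k : ℕ) :
    (formTuples n k).map (combMap A) = formTuples m (k + e) ⊓ LinearMap.range (combMap A) := by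
  ext w
  simp only [Submodule.mem_map, Submodule.mem_inf, LinearMap.mem_range]
  constructor
  · rintro ⟨a, ha, rfl⟩
    refine ⟨mem_formTuples.2 fun l => ?_, a, rfl⟩
    rw [combMap_apply]
    exact IsHomogeneous.sum _ _ _ fun j _ => (mem_formTuples.1 ha j).mul (hA j l)
  · rintro ⟨hw, a, rfl⟩
    refine ⟨fun j => homogeneousComponent k (a j),
      mem_formTuples.2 fun j => homogeneousComponent_isHomogeneous k (a j), funext fun l => ?_⟩
    have := homogeneousComponent_of_mem (m := k + e) (mem_formTuples.1 hw l)
    rw [if_pos rfl] at this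
    rw [← this, combMap_apply, combMap_apply, map_sum]
    exact Finset.sum_congr rfl fun j _ => (homogeneousComponent_mul_of_isHomogeneous (hA j l)).symm

theorem finrank_map_add_finrank_inf_ker {n m : ℕ} (A : Fin n → Fin m → S3) (k : ℕ) :
    Module.finrank ℂ ((formTuples n k).map (combMap A)) +
      Module.finrank ℂ ↥(formTuples n k ⊓ LinearMap.ker (combMap A)) =
      n * Module.finrank ℂ (homogeneousSubmodule (Fin 3) ℂ k) := by
  rw [← finrank_formTuples,
    ← LinearMap.finrank_range_add_finrank_ker ((combMap A).domRestrict (formTuples n k)),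
    LinearMap.range_domRestrict, LinearMap.ker_domRestrict,
    ← Submodule.finrank_map_subtype_eq, Submodule.map_comap_subtype]

theorem milnorDim_add_finrank (f : S3) (k : ℕ) :
    milnorDim f k + Module.finrank ℂ ↥(homogeneousSubmodule (Fin 3) ℂ k ⊓
      Submodule.restrictScalars ℂ (jacobianIdeal f)) =
      Module.finrank ℂ (homogeneousSubmodule (Fin 3) ℂ k) := by
  rw [milnorDim, ← Submodule.map_comap_subtype, Submodule.finrank_map_subtype_eq]
  exact Submodule.finrank_quotient_add_finrank _

theorem mem_jacobianIdeal {f w : S3} :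
    w ∈ jacobianIdeal f ↔ ∃ a : Fin 3 → S3, ∑ l, a l * pderiv l f = w := by
  have hset : ({pderiv 0 f, pderiv 1 f, pderiv 2 f} : Set S3) =
      Set.range fun l : Fin 3 => pderiv l f := by
    ext u
    simp [Fin.exists_fin_succ, eq_comm]
  rw [jacobianIdeal, hset, Ideal.mem_span_range_iff_exists_fun]

theorem finrank_inf_jacobianIdeal (f : S3) (k : ℕ) :
    Module.finrank ℂ ↥(homogeneousSubmodule (Fin 3) ℂ k ⊓
      Submodule.restrictScalars ℂ (jacobianIdeal f)) =
    Module.finrank ℂ ↥(formTuples 1 k ⊓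
      LinearMap.range (combMap fun (l : Fin 3) (_ : Fin 1) => pderiv l f)) := by
  set A : Fin 3 → Fin 1 → S3 := fun l _ => pderiv l f
  have happly : ∀ a, combMap A a = fun _ => ∑ l, a l * pderiv l f := fun a =>
    funext fun _ => combMap_apply A a _
  have hmap : homogeneousSubmodule (Fin 3) ℂ k ⊓ Submodule.restrictScalars ℂ (jacobianIdeal f) =
      (formTuples 1 k ⊓ LinearMap.range (combMap A)).map (LinearMap.proj 0) := by
    ext w
    rw [Submodule.mem_inf, Submodule.restrictScalars_mem, mem_jacobianIdeal, Submodule.mem_map]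
    constructor
    · rintro ⟨hw, a, rfl⟩
      exact ⟨fun _ => ∑ l, a l * pderiv l f, ⟨mem_formTuples.2 fun _ => hw, a, happly a⟩, rfl⟩
    · rintro ⟨_, ⟨hw, a, rfl⟩, rfl⟩
      refine ⟨mem_formTuples.1 hw 0, a, ?_⟩
      rw [happly]
      rfl
  rw [hmap]
  refine (Submodule.equivMapOfInjective _ (fun a b hab => ?_) _).finrank_eq.symm
  funext j
  rw [Subsingleton.elim j 0]
  exact hab

/-! ### Resolutions of the module of Jacobian syzygies -/

/-- `S² → S⁴ → D_0(f) → 0` is a presentation of `D_0(f)`, with injective first map. -/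
structure IsJacobianResolution (f : S3) (v : Fin 4 → Fin 3 → S3) (p q : Fin 4 → S3) : Prop where
  span_eq : Submodule.span S3 (Set.range v) = jacSyz f
  rel_left : comb v p = 0
  rel_right : comb v q = 0
  exists_relation : ∀ a, comb v a = 0 → ∃ c d, ∀ j, a j = p j * c + q j * d
  minor_ne : minorTwo p q 2 3 ≠ 0

theorem IsSyzComplex.isJacobianResolution {f : S3} {g : Fin 3 → S3} {v : Fin 4 → Fin 3 → S3}
    {p q : Fin 4 → S3} (h : IsSyzComplex g v p q) {c : ℂ} (hc : c ≠ 0)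
    (hg : ∀ l, g l = C c * pderiv l f) {i j k : ℕ}
    (hJ : (X 0 : S3) ^ i * X 1 ^ j * X 2 ^ k ∈ jacobianIdeal f) :
    IsJacobianResolution f v p q where
  span_eq := by
    have hC : (C c : S3) ≠ 0 := by simpa using hc
    refine le_antisymm (Submodule.span_le.2 ?_) fun w hw => h.mem_span (i := i) (j := j) (k := k)
      ?_ ?_
    · rintro _ ⟨j, rfl⟩
      have := h.syz j
      rw [hg, hg, hg] at this
      refine mul_left_cancel₀ hC ?_
      linear_combination this
    · refine (Ideal.span_le.2 ?_ : jacobianIdeal f ≤ _) hJ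
      have hmem : ∀ l, pderiv l f ∈ Ideal.span (Set.range g) := by
        intro l
        have : pderiv l f = C c⁻¹ * g l := by
          rw [hg, ← mul_assoc, ← C_mul, inv_mul_cancel₀ hc, C_1, one_mul]
        rw [this]
        exact Ideal.mul_mem_left _ _ (Ideal.subset_span ⟨l, rfl⟩)
      rintro _ (rfl | rfl | rfl)
      exacts [hmem 0, hmem 1, hmem 2]
    · rw [hg, hg, hg]
      have : w 0 * pderiv 0 f + w 1 * pderiv 1 f + w 2 * pderiv 2 f = 0 := hw
      linear_combination C c * this
  rel_left := funext h.rel_left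
  rel_right := funext h.rel_right
  exists_relation := fun _ => h.exists_relation
  minor_ne := h.minor_ne

namespace IsJacobianResolution

variable {f : S3} {v : Fin 4 → Fin 3 → S3} {p q : Fin 4 → S3}

theorem milnorDim_add (h : IsJacobianResolution f v p q) {r e : ℕ}
    (hv : ∀ j l, (v j l).IsHomogeneous r) (hp : ∀ j, (p j).IsHomogeneous 1)
    (hq : ∀ j, (q j).IsHomogeneous 1) (hf : f.IsHomogeneous (e + 1)) (m : ℕ) :
    2 * milnorDim f (m + 1 + r + e) + 3 * ((m + 1 + r + 2) * (m + 1 + r + 1)) +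
      2 * ((m + 2) * (m + 1)) =
    (m + 1 + r + e + 2) * (m + 1 + r + e + 1) + 4 * ((m + 1 + 2) * (m + 1 + 1)) := by
  set g : Fin 3 → Fin 1 → S3 := fun l _ => pderiv l f with hg
  have hgh : ∀ l i, (g l i).IsHomogeneous e := fun l _ => hf.pderiv
  have hP : ∀ j l, ((![p, q] : Fin 2 → Fin 4 → S3) j l).IsHomogeneous 1 := by
    intro j l
    fin_cases j
    exacts [hp l, hq l]
  have kerP : LinearMap.ker (combMap ![p, q]) = ⊥ := by
    refine LinearMap.ker_eq_bot'.2 fun a ha => ?_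
    have ha' : ∀ l, a 0 * p l + a 1 * q l = 0 := fun l => by
      simpa [combMap_apply] using congrFun ha l
    have h0 : minorTwo p q 2 3 * a 0 = 0 := by
      simp only [minorTwo]; linear_combination q 3 * ha' 2 - q 2 * ha' 3
    have h1 : minorTwo p q 2 3 * a 1 = 0 := by
      simp only [minorTwo]; linear_combination p 2 * ha' 3 - p 3 * ha' 2
    funext j
    fin_cases j
    exacts [(mul_eq_zero.1 h0).resolve_left h.minor_ne, (mul_eq_zero.1 h1).resolve_left h.minor_ne]
  have comb_eq : ∀ a, combMap v a = comb v a := fun a => funext fun l => by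
    rw [combMap_apply, Fin.sum_univ_four]; rfl
  have kerv : LinearMap.ker (combMap v) = LinearMap.range (combMap ![p, q]) := by
    ext a
    rw [LinearMap.mem_ker, LinearMap.mem_range, comb_eq]
    constructor
    · intro ha
      obtain ⟨c, d, hcd⟩ := h.exists_relation a ha
      refine ⟨![c, d], funext fun l => ?_⟩
      rw [combMap_apply, Fin.sum_univ_two, hcd]
      simp only [Matrix.cons_val_zero, Matrix.cons_val_one]
      ring
    · rintro ⟨b, rfl⟩
      funext l
      have hl := congrFun h.rel_left l
      have hr := congrFun h.rel_right l
      simp only [comb, combMap_apply, Fin.sum_univ_two, Matrix.cons_val_zero, Matrix.cons_val_one,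
        Pi.zero_apply] at hl hr ⊢
      linear_combination b 0 * hl + b 1 * hr
  have kerg : LinearMap.ker (combMap g) = LinearMap.range (combMap v) := by
    ext w
    have hw : w ∈ jacSyz f ↔ combMap g w = 0 := by
      rw [funext_iff, Unique.forall_iff, combMap_apply, Fin.sum_univ_three]
      rfl
    rw [LinearMap.mem_ker, ← hw, ← h.span_eq, mem_span_range_iff_comb]
    simp only [LinearMap.mem_range, comb_eq]
  have e1 := finrank_map_add_finrank_inf_ker ![p, q] m
  rw [kerP, inf_bot_eq, finrank_bot, map_combMap_formTuples hP, ← kerv] at e1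
  have e2 := finrank_map_add_finrank_inf_ker v (m + 1)
  rw [map_combMap_formTuples hv, ← kerg] at e2
  have e3 := finrank_map_add_finrank_inf_ker g (m + 1 + r)
  rw [map_combMap_formTuples hgh] at e3
  have e4 := milnorDim_add_finrank f (m + 1 + r + e)
  rw [finrank_inf_jacobianIdeal] at e4
  have s0 := two_mul_finrank_homogeneousSubmodule m
  have s1 := two_mul_finrank_homogeneousSubmodule (m + 1)
  have s2 := two_mul_finrank_homogeneousSubmodule (m + 1 + r)
  have s3 := two_mul_finrank_homogeneousSubmodule (m + 1 + r + e)
  rw [← s0, ← s1, ← s2, ← s3]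
  linarith

theorem isMDR (h : IsJacobianResolution f v p q) {r : ℕ}
    (hv : ∀ j l, (v j l).IsHomogeneous r) (h0 : v 0 ≠ 0) : IsMDR f r := by
  refine ⟨⟨v 0, h.span_eq ▸ Submodule.subset_span ⟨0, rfl⟩, h0, hv 0⟩, fun m hm w hw hwm => ?_⟩
  rw [← h.span_eq, mem_span_range_iff_comb] at hw
  obtain ⟨a, rfl⟩ := hw
  funext l
  have := homogeneousComponent_of_mem (m := m) (hwm l)
  rw [if_pos rfl] at this
  rw [← this, comb]
  simp only [map_add, homogeneousComponent_mul_of_lt (hv _ l) hm, add_zero, Pi.zero_apply]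

/-- A subfamily of the `v j`, the others being zero, is a minimal system of generators if the
corresponding entries of the relations have no constant term. -/
theorem isMinGenSyz (h : IsJacobianResolution f v p q) {m : ℕ} (e : Fin m ↪ Fin 4)
    (he : ∀ j, j ∉ Set.range e → v j = 0) (hp : ∀ i, constantCoeff (p (e i)) = 0)
    (hq : ∀ i, constantCoeff (q (e i)) = 0) {dd : Fin m → ℕ}
    (hv : ∀ i l, (v (e i) l).IsHomogeneous (dd i)) (hdd : Monotone dd) :
    IsMinGenSyz f m dd fun i => v (e i) := by
  have minimal : ∀ i, v (e i) ∉ Submodule.span S3 ((fun i => v (e i)) '' {j | j ≠ i}) := by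
    intro i hi
    have hle : Submodule.span S3 ((fun i => v (e i)) '' {j | j ≠ i}) ≤
        Submodule.span S3 (v '' {j | j ≠ e i}) := by
      refine Submodule.span_mono ?_
      rintro _ ⟨j, hj, rfl⟩
      exact ⟨e j, fun h => hj (e.injective h), rfl⟩
    obtain ⟨a, ha, hav⟩ := (Finsupp.mem_span_image_iff_linearCombination S3).1 (hle hi)
    rw [Finsupp.linearCombination_apply, Finsupp.sum_fintype _ _ (by simp),
      Fin.sum_univ_four] at hav
    have hai : a (e i) = 0 := by
      by_contra hne
      exact (Finsupp.mem_supported S3 a).1 ha (Finsupp.mem_support_iff.2 hne) rfl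
    have hcomb : comb v (⇑a - Pi.single (e i) 1) = 0 := by
      have hsingle : comb v (Pi.single (e i) 1) = v (e i) := by
        generalize e i = k
        funext l
        fin_cases k <;> simp [comb]
      have hsub : comb v (⇑a - Pi.single (e i) 1) = comb v a - comb v (Pi.single (e i) 1) := by
        funext l
        simp only [comb, Pi.sub_apply]
        ring
      rw [hsub, hsingle, ← hav, sub_eq_zero]
      rfl
    obtain ⟨c, d, hcd⟩ := h.exists_relation _ hcomb
    have := congrArg constantCoeff (hcd (e i))
    simp [hai, hp, hq] at this
  refine ⟨fun i => h.span_eq ▸ Submodule.subset_span ⟨e i, rfl⟩, hv, fun i hi => ?_, ?_, minimal,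
    hdd⟩
  · exact minimal i (by rw [hi]; exact zero_mem _)
  · rw [← h.span_eq]
    refine le_antisymm (Submodule.span_mono ?_) (Submodule.span_le.2 ?_)
    · rintro _ ⟨i, rfl⟩
      exact ⟨e i, rfl⟩
    · rintro _ ⟨j, rfl⟩
      by_cases hj : j ∈ Set.range e
      · obtain ⟨i, rfl⟩ := hj
        exact Submodule.subset_span ⟨i, rfl⟩
      · rw [he j hj]
        exact zero_mem _

end IsJacobianResolution

namespace IsJacobianResolution

variable {f : S3} {v : Fin 4 → Fin 3 → S3} {p q : Fin 4 → S3}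

theorem isMaxTjurina (h : IsJacobianResolution f v p q) {s : ℕ} (hs : 1 ≤ s)
    (hv : ∀ j l, (v j l).IsHomogeneous (s + 1)) (hp : ∀ j, (p j).IsHomogeneous 1)
    (hq : ∀ j, (q j).IsHomogeneous 1) (hf : f.IsHomogeneous (2 * s + 1)) (h0 : v 0 ≠ 0) :
    IsMaxTjurina f (2 * s + 1) (s + 1) := by
  have hle : 2 ≤ 3 * s ^ 2 := by nlinarith
  refine ⟨h.isMDR hv h0, by omega, 3 * s ^ 2 - 2, ?_, ?_⟩
  · refine Filter.eventually_atTop.2 ⟨1 + (s + 1) + 2 * s, fun k hk => ?_⟩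
    obtain ⟨m, rfl⟩ : ∃ m, k = m + 1 + (s + 1) + 2 * s := ⟨k - (1 + (s + 1) + 2 * s), by omega⟩
    have := h.milnorDim_add hv hp hq hf m
    zify [hle] at this ⊢
    linarith
  · rw [show 2 * (s + 1) + 2 - (2 * s + 1) = 3 by omega]
    push_cast [Nat.cast_sub hle, show Nat.choose 3 2 = 3 from rfl]
    ring

theorem isMinGenSyz_castLE (h : IsJacobianResolution f v p q) {m : ℕ} (hm : m ≤ 4)
    (hvm : ∀ j : Fin 4, m ≤ j → v j = 0) (hp : ∀ i, constantCoeff (p (Fin.castLE hm i)) = 0)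
    (hq : ∀ i, constantCoeff (q (Fin.castLE hm i)) = 0) {dd : Fin m → ℕ}
    (hv : ∀ i l, (v (Fin.castLE hm i) l).IsHomogeneous (dd i)) (hdd : Monotone dd) :
    IsMinGenSyz f m dd fun i => v (Fin.castLE hm i) :=
  h.isMinGenSyz (Fin.castLEEmb hm) (fun j hj => hvm j (by simpa using hj)) hp hq hv hdd

end IsJacobianResolution

theorem not_X_dvd_of_eval_ne_zero {k : Fin 3} {u : S3} {x : Fin 3 → ℂ} (hx : x k = 0)
    (hu : eval x u ≠ 0) : ¬ X k ∣ u := by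
  rintro ⟨w, rfl⟩
  simp [hx] at hu

theorem isHomogeneous_of_intCast_mul {f : S3} {N : ℤ} {n : ℕ} (hN : N ≠ 0)
    (h : ((N : S3) * f).IsHomogeneous n) : f.IsHomogeneous n := by
  have : f = C ((N : ℂ)⁻¹) * ((N : S3) * f) := by
    rw [← map_intCast (C : ℂ →+* S3), ← mul_assoc, ← C_mul,
      inv_mul_cancel₀ (Int.cast_ne_zero.2 hN), C_1, one_mul]
  rw [this]
  simpa using (isHomogeneous_C (Fin 3) (N : ℂ)⁻¹).mul h

/-- A criterion for `IsJacobianResolution` in which denominators are cleared: `G` is a multiple of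
the gradient of `f`. -/
theorem isJacobianResolution_of_certificate {f : S3} {G : Fin 3 → S3} {v : Fin 4 → Fin 3 → S3}
    {p q : Fin 4 → S3} {N α β : ℤ} (hN : N ≠ 0) (hα : α ≠ 0) (hβ : β ≠ 0)
    (hG : ∀ l, (N : S3) * pderiv l f = G l)
    (rel_left : ∀ l, p 0 * v 0 l + p 1 * v 1 l + p 2 * v 2 l + p 3 * v 3 l = 0)
    (rel_right : ∀ l, q 0 * v 0 l + q 1 * v 1 l + q 2 * v 2 l + q 3 * v 3 l = 0)
    (minor_ne : minorTwo p q 2 3 ≠ 0)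
    (wedge_eq : ∀ l, (α : S3) * wedge (v 0) (v 1) l = β * (minorTwo p q 2 3 * G l))
    (sq_mem : ∀ k, ∃ K : ℤ, K ≠ 0 ∧ (K : S3) * X k ^ 2 ∈ minorIdeal p q)
    (not_dvd : ∀ k, ∃ l, ¬ (X k : S3) ∣ G l) {K : ℤ} (hK : K ≠ 0) {i j k : ℕ} {A : Fin 3 → S3}
    (hJ : A 0 * G 0 + A 1 * G 1 + A 2 * G 2 = (K : S3) * (X 0 ^ i * X 1 ^ j * X 2 ^ k)) :
    IsJacobianResolution f v p q := by
  have cast : ∀ n : ℤ, (n : S3) = C (n : ℂ) := fun n => (map_intCast (C : ℂ →+* S3) n).symm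
  have cast_ne : ∀ {n : ℤ}, n ≠ 0 → (n : S3) ≠ 0 := fun hn => Int.cast_ne_zero.2 hn
  have mem_of_cast_mul : ∀ (I : Ideal S3) {n : ℤ} {u : S3}, n ≠ 0 → (n : S3) * u ∈ I → u ∈ I := by
    intro I n u hn hu
    have : C ((n : ℂ)⁻¹) * ((n : S3) * u) = u := by
      rw [cast, ← mul_assoc, ← C_mul, inv_mul_cancel₀ (Int.cast_ne_zero.2 hn), C_1, one_mul]
    exact this ▸ I.mul_mem_left _ hu
  set c : ℂ := (β : ℂ) / α with hc
  have hc0 : c ≠ 0 := div_ne_zero (Int.cast_ne_zero.2 hβ) (Int.cast_ne_zero.2 hα)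
  have hαc : (α : S3) * C c = (β : S3) := by
    rw [cast, cast, ← C_mul, mul_div_cancel₀ _ (Int.cast_ne_zero.2 hα)]
  have hw : ∀ l, wedge (v 0) (v 1) l = minorTwo p q 2 3 * (C c * G l) := fun l =>
    mul_left_cancel₀ (cast_ne hα) (by linear_combination wedge_eq l - minorTwo p q 2 3 * G l * hαc)
  have w0 := hw 0
  have w1 := hw 1
  have w2 := hw 2
  simp only [wedge, Fin.isValue, zero_add, Fin.reduceAdd] at w0 w1 w2
  have syz0 : v 0 0 * (C c * G 0) + v 0 1 * (C c * G 1) + v 0 2 * (C c * G 2) = 0 :=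
    mul_left_cancel₀ minor_ne
      (by linear_combination -v 0 0 * w0 - v 0 1 * w1 - v 0 2 * w2)
  have syz1 : v 1 0 * (C c * G 0) + v 1 1 * (C c * G 1) + v 1 2 * (C c * G 2) = 0 :=
    mul_left_cancel₀ minor_ne
      (by linear_combination -v 1 0 * w0 - v 1 1 * w1 - v 1 2 * w2)
  have h : IsSyzComplex (fun l => C c * G l) v p q := by
    refine ⟨fun j => ?_, rel_left, rel_right, minor_ne, hw, fun k => ?_, fun k => ?_⟩
    · fin_cases j
      · exact syz0
      · exact syz1
      · refine mul_left_cancel₀ minor_ne ?_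
        simp only [minorTwo, Fin.reduceFinMk]
        linear_combination
          C c * G 0 * (q 3 * rel_left 0 - p 3 * rel_right 0) +
          C c * G 1 * (q 3 * rel_left 1 - p 3 * rel_right 1) +
          C c * G 2 * (q 3 * rel_left 2 - p 3 * rel_right 2) -
          (p 0 * q 3 - p 3 * q 0) * syz0 - (p 1 * q 3 - p 3 * q 1) * syz1
      · refine mul_left_cancel₀ minor_ne ?_
        simp only [minorTwo, Fin.reduceFinMk]
        linear_combination
          C c * G 0 * (p 2 * rel_right 0 - q 2 * rel_left 0) +
          C c * G 1 * (p 2 * rel_right 1 - q 2 * rel_left 1) +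
          C c * G 2 * (p 2 * rel_right 2 - q 2 * rel_left 2) -
          (p 2 * q 0 - p 0 * q 2) * syz0 - (p 2 * q 1 - p 1 * q 2) * syz1
    · obtain ⟨K, hK, hmem⟩ := sq_mem k
      exact mem_of_cast_mul _ hK hmem
    · obtain ⟨l, hl⟩ := not_dvd k
      refine ⟨l, fun hd => hl ?_⟩
      have : G l = C c⁻¹ * (C c * G l) := by
        rw [← mul_assoc, ← C_mul, inv_mul_cancel₀ hc0, C_1, one_mul]
      exact this ▸ hd.mul_left _
  refine h.isJacobianResolution (f := f) (c := c * N) (i := i) (j := j) (k := k)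
    (mul_ne_zero hc0 (Int.cast_ne_zero.2 hN)) (fun l => ?_)
    (mem_of_cast_mul _ hK (mem_jacobianIdeal.2 ⟨fun l => A l * N, ?_⟩))
  · rw [← hG, cast, C_mul, mul_assoc]
  · rw [Fin.sum_univ_three, ← hJ, ← hG, ← hG, ← hG]
    ring

/-! ### Forms given by lists of coefficients -/

/-- The form of degree `n` with terms `c x ^ i y ^ j z ^ (n - i - j)` for `(c, i, j)` in `l`. -/
def form (n : ℕ) (l : List (ℤ × ℕ × ℕ)) : S3 :=
  (l.map fun t => (t.1 : S3) * X 0 ^ t.2.1 * X 1 ^ t.2.2 * X 2 ^ (n - t.2.1 - t.2.2)).sum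

theorem form_nil (n : ℕ) : form n [] = 0 := rfl

theorem form_cons (n : ℕ) (c : ℤ) (i j : ℕ) (l : List (ℤ × ℕ × ℕ)) :
    form n ((c, i, j) :: l) = (c : S3) * X 0 ^ i * X 1 ^ j * X 2 ^ (n - i - j) + form n l := by
  simp [form]

theorem isHomogeneous_form {n : ℕ} {l : List (ℤ × ℕ × ℕ)} (h : ∀ t ∈ l, t.2.1 + t.2.2 ≤ n) :
    (form n l).IsHomogeneous n := by
  induction l with
  | nil => exact isHomogeneous_zero _ _ _
  | cons t l ih =>
    obtain ⟨c, i, j⟩ := t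
    rw [form_cons]
    refine IsHomogeneous.add ?_ (ih fun t ht => h t (List.mem_cons_of_mem _ ht))
    have hij : i + j ≤ n := h _ List.mem_cons_self
    convert (((isHomogeneous_C (Fin 3) (c : ℂ)).mul (isHomogeneous_X_pow (0 : Fin 3) i)).mul
      (isHomogeneous_X_pow (1 : Fin 3) j)).mul (isHomogeneous_X_pow (2 : Fin 3) (n - i - j)) using 1
    · simp
    · omega

theorem constantCoeff_form {n : ℕ} {l : List (ℤ × ℕ × ℕ)} (hn : n ≠ 0)
    (h : ∀ t ∈ l, t.2.1 + t.2.2 ≤ n) : constantCoeff (form n l) = 0 := by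
  by_contra hne
  exact hn (by simpa using (isHomogeneous_form h hne).symm)

/-- The partial derivatives of `form n l`, as forms. -/
def formGradient (n : ℕ) (l : List (ℤ × ℕ × ℕ)) : Fin 3 → S3 :=
  ![form (n - 1) (l.map fun t => (t.1 * t.2.1, t.2.1 - 1, t.2.2)),
    form (n - 1) (l.map fun t => (t.1 * t.2.2, t.2.1, t.2.2 - 1)),
    form (n - 1) (l.map fun t => (t.1 * (n - t.2.1 - t.2.2 : ℕ), t.2.1, t.2.2))]

theorem pderiv_form (n : ℕ) (l : List (ℤ × ℕ × ℕ)) (k : Fin 3) :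
    pderiv k (form n l) = formGradient n l k := by
  induction l with
  | nil => fin_cases k <;> simp [form_nil, formGradient]
  | cons t l ih =>
    obtain ⟨c, i, j⟩ := t
    have hc : ∀ k, pderiv k (c : S3) = 0 := fun k => Derivation.map_intCast _ c
    rw [form_cons, map_add, ih]
    fin_cases k
    · rcases i with _ | i
      · simp [formGradient, form_cons, hc, pderiv_X]
      · simp [formGradient, form_cons, hc, pderiv_X]
        rw [show n - (i + 1) - j = n - 1 - i - j by omega]
        ring
    · rcases j with _ | j
      · simp [formGradient, form_cons, hc, pderiv_X]
      · simp [formGradient, form_cons, hc, pderiv_X]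
        rw [show n - i - (j + 1) = n - 1 - i - j by omega]
        ring
    · simp [formGradient, form_cons, hc, pderiv_X]
      rw [show n - i - j - 1 = n - 1 - i - j by omega]
      ring

theorem intCast_mul_pderiv {f : S3} {N : ℤ} {n : ℕ} {l : List (ℤ × ℕ × ℕ)}
    (h : (N : S3) * f = form n l) (k : Fin 3) :
    (N : S3) * pderiv k f = formGradient n l k := by
  rw [← pderiv_form, ← h, Derivation.leibniz, Derivation.map_intCast]
  simp

/-! ### The six curves -/

theorem three_mul_f0 : (3 : S3) * f0 = form 10
    [(3, 6, 4), (12, 5, 3), (9, 4, 3), (18, 4, 2), (19, 3, 2), (12, 3, 1), (9, 2, 2), (11, 2,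
      1), (3, 2, 0), (6, 1, 1), (1, 1, 0), (3, 0, 1), (-3, 0, 0)] := by
  have hC : ∀ n : ℕ, (3 : S3) * C ((n : ℂ) / 3) = (n : S3) := fun n => by
    rw [show (3 : S3) = C 3 from (map_ofNat (C : ℂ →+* S3) 3).symm, ← C_mul, mul_div_cancel₀ _ three_ne_zero,
      map_natCast]
  have h19 := hC 19
  have h11 := hC 11
  have h1 := hC 1
  simp only [f0, form_cons, form_nil]
  push_cast at h19 h11 h1 ⊢
  linear_combination X 0 ^ 3 * X 1 ^ 2 * X 2 ^ 5 * h19 + X 0 ^ 2 * X 1 * X 2 ^ 7 * h11 +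
    X 0 * X 2 ^ 9 * h1

/-- The terms of `3 * X 0 * f0`. -/
def xfTerms : List (ℤ × ℕ × ℕ) :=
  [(3, 7, 4), (12, 6, 3), (9, 5, 3), (18, 5, 2), (19, 4, 2), (12, 4, 1), (9, 3, 2), (11, 3, 1),
    (3, 3, 0), (6, 2, 1), (1, 2, 0), (3, 1, 1), (-3, 1, 0)]

/-- Generators of the Jacobian syzygies of `X 0 * f0`. -/
def xfSyz : Fin 4 → Fin 3 → S3 :=
  ![![form 5 [(2560000, 4, 1), (-57132, 3, 2), (-587520, 3, 1), (2560000, 3, 0), (-280044, 2,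
       1), (1332480, 2, 0), (-36639, 1, 1), (299328, 1, 0)],
     form 5 [(-4480000, 3, 2), (99981, 2, 3), (1104192, 2, 2), (-5888000, 2, 1), (623430, 1,
       2), (-800640, 1, 1), (-1408000, 1, 0), (58995, 0, 2), (-450663, 0, 1), (399168, 0, 0)],
     form 5 [(-38016, 3, 2), (-256000, 3, 1), (-2484, 2, 2), (-17280, 2, 1), (-256000, 2, 0),
       (-30564, 1, 1), (-171264, 1, 0), (-2484, 0, 1), (9984, 0, 0)]],
    ![form 6 [(3040870400, 5, 1), (-56401920, 4, 2), (-597688320, 4, 1), (3040870400, 4, 0),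
       (-514188, 3, 3), (-7354368, 3, 2), (-409313280, 3, 1), (1682964480, 3, 0), (-2520396,
       2, 2), (-49084416, 2, 1), (432537600, 2, 0), (-329751, 1, 2), (1368576, 1, 1)],
     form 6 [(-5321523200, 4, 2), (98703360, 3, 3), (1149763584, 3, 2), (-6994001920, 3, 1),
       (899829, 2, 4), (13554432, 2, 3), (889651200, 2, 2), (-1154482176, 2, 1),
       (-1672478720, 2, 0), (5610870, 1, 3), (97378560, 1, 2), (-546281472, 1, 1),
       (432537600, 1, 0), (530955, 0, 3), (-1921887, 0, 2), (1368576, 0, 1)],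
     form 6 [(-51904512, 4, 2), (-304087040, 4, 1), (-342144, 3, 3), (-7133184, 3, 2),
       (-44040192, 3, 1), (-304087040, 3, 0), (-22356, 2, 3), (-245376, 2, 2), (-44832768, 2,
       1), (-220200960, 2, 0), (-275076, 1, 2), (-6100992, 1, 1), (-22356, 0, 2)]],
    ![form 6 [(11489198080, 5, 1), (-739320048, 4, 2), (-2216094720, 4, 1), (11489198080, 4,
       0), (6684444, 3, 3), (95606784, 3, 2), (-2559829488, 3, 1), (6400803840, 3, 0),
       (32765148, 2, 2), (-306252108, 2, 1), (1610619648, 2, 0), (4286763, 1, 2), (-17791488,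
       1, 1), (-177914880, 1, 0)],
     form 6 [(-20106096640, 4, 2), (1293810084, 3, 3), (4335168768, 3, 2), (-26425155584, 3,
       1), (-11697777, 2, 4), (-176207616, 2, 3), (5490904632, 2, 2), (-4329254400, 2, 1),
       (-6319058944, 2, 0), (-72941310, 1, 3), (254641500, 1, 2), (-1325123052, 1, 1),
       (1675855104, 1, 0), (-6902415, 0, 3), (24984531, 0, 2)],
     form 6 [(-228501504, 4, 2), (-1148919808, 4, 1), (4447872, 3, 3), (28707696, 3, 2),
       (-235393536, 3, 1), (-1148919808, 3, 0), (290628, 2, 3), (3189888, 2, 2), (-110571600,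
       2, 1), (-868581888, 2, 0), (3575988, 1, 2), (15289200, 1, 1), (290628, 0, 2),
       (17791488, 0, 0)]],
    0]

/-- The first relation between the syzygies `xfSyz`. -/
def xfLeft : Fin 4 → S3 :=
  ![form 2 [(37371248640, 2, 0), (3046450176, 1, 1), (-11678515200, 1, 0), (14939397, 0, 2),
      (-36951552, 0, 1)],
    form 1 [(-56222720, 1, 0), (-1390365, 0, 1), (10777536, 0, 0)],
    form 1 [(6553600, 1, 0), (20736, 0, 1)],
    0]

/-- The second relation between the syzygies `xfSyz`. -/
def xfRight : Fin 4 → S3 :=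
  ![0, 0, 0, 1]

theorem intCast_mul_X_zero_mul_f0 : ((3 : ℤ) : S3) * (X 0 * f0) = form 11 xfTerms := by
  have hf := three_mul_f0
  simp only [xfTerms, form_cons, form_nil] at hf ⊢
  push_cast at hf ⊢
  linear_combination (X 0) * hf

set_option maxHeartbeats 2000000 in
theorem isJacobianResolution_X_zero_mul_f0 :
    IsJacobianResolution (X 0 * f0) xfSyz xfLeft xfRight := by
  refine isJacobianResolution_of_certificate (N := 3) (α := 1) (β := 219648) (K := 33)
    (i := 1) (j := 0) (k := 14) (by norm_num) (by norm_num) (by norm_num)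
    (intCast_mul_pderiv intCast_mul_X_zero_mul_f0) (fun l => ?_) (fun l => ?_) ?_ (fun l => ?_) (fun k => ?_)
    (fun k => ?_) (by norm_num)
    (A := ![form 5 [(40, 4, 1), (40, 3, 0), (10, 2, 0)],
      form 5 [(-70, 3, 2), (-92, 2, 1), (-1, 1, 1), (-22, 1, 0), (11, 0, 0)],
      form 5 [(-4, 3, 1), (-4, 2, 0), (-1, 1, 0)]]) ?_
  · fin_cases l <;>
      · simp [xfSyz, xfLeft, form_cons, form_nil]
        ring
  · fin_cases l <;> simp [xfSyz, xfRight, form_cons, form_nil]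
  · refine fun h => ?_
    have := congrArg (eval ![0, 1, 0]) h
    simp [minorTwo, xfLeft, xfRight, form_cons, form_nil] at this
  · fin_cases l <;>
      · simp only [wedge, minorTwo, xfSyz, xfLeft, xfRight, formGradient, xfTerms, form_cons, form_nil, List.map_cons,
          List.map_nil, Fin.zero_eta, Fin.mk_one, Fin.reduceFinMk, Fin.isValue, Fin.reduceAdd,
          zero_add, Matrix.cons_val, Nat.reduceSub, Nat.cast_ofNat, Int.reduceMul, Int.reduceNeg]
        push_cast
        ring
  · fin_cases k
    · refine ⟨27423919161999360, by norm_num, ?_⟩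
      set I := minorIdeal xfLeft xfRight
      convert add_mem (add_mem (I.mul_mem_left (form 0 [(48384, 0, 0)]) (minorTwo_mem _ _ 0 3))
          (I.mul_mem_left (form 1 [(52428800, 1, 0), (165888, 0, 1)]) (minorTwo_mem _ _ 1
          3))) (I.mul_mem_left (form 1 [(4358434816, 1, 0), (-23735673, 0, 1)])
          (minorTwo_mem _ _ 2 3)) using 1
      simp [minorTwo, xfLeft, xfRight, form_cons, form_nil]
      ring
    · refine ⟨34318606113792, by norm_num, ?_⟩
      set I := minorIdeal xfLeft xfRight
      convert add_mem (add_mem (I.mul_mem_left (form 0 [(6048000, 0, 0)]) (minorTwo_mem _ _ 0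
          3)) (I.mul_mem_left (form 1 [(6553600000, 1, 0), (20736000, 0, 1)])
          (minorTwo_mem _ _ 1 3))) (I.mul_mem_left (form 1 [(21734604800, 1, 0),
          (-1311933753, 0, 1)]) (minorTwo_mem _ _ 2 3)) using 1
      simp [minorTwo, xfLeft, xfRight, form_cons, form_nil]
      ring
    · refine ⟨386564779265753088, by norm_num, ?_⟩
      set I := minorIdeal xfLeft xfRight
      convert add_mem (add_mem (I.mul_mem_left (form 0 [(862202880, 0, 0)]) (minorTwo_mem _ _ 0
          3)) (I.mul_mem_left (form 1 [(1121390428160, 1, 0), (7583258880, 0, 1),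
          (35867639808, 0, 0)]) (minorTwo_mem _ _ 1 3))) (I.mul_mem_left (form 1
          [(4703677649920, 1, 0), (-112716694935, 0, 1)]) (minorTwo_mem _ _ 2 3)) using 1
      simp [minorTwo, xfLeft, xfRight, form_cons, form_nil]
      ring
  · fin_cases k
    · refine ⟨0, not_X_dvd_of_eval_ne_zero (x := ![0, 0, 1]) rfl ?_⟩
      simp [formGradient, xfTerms, form_cons, form_nil]
    · refine ⟨0, not_X_dvd_of_eval_ne_zero (x := ![0, 0, 1]) rfl ?_⟩
      simp [formGradient, xfTerms, form_cons, form_nil]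
    · refine ⟨0, not_X_dvd_of_eval_ne_zero (x := ![1, 1, 0]) rfl ?_⟩
      simp [formGradient, xfTerms, form_cons, form_nil]
  · simp [formGradient, xfTerms, form_cons, form_nil]
    ring

/-- The terms of `3 * X 1 * f0`. -/
def yfTerms : List (ℤ × ℕ × ℕ) :=
  [(3, 6, 5), (12, 5, 4), (9, 4, 4), (18, 4, 3), (19, 3, 3), (12, 3, 2), (9, 2, 3), (11, 2, 2),
    (3, 2, 1), (6, 1, 2), (1, 1, 1), (3, 0, 2), (-3, 0, 1)]

/-- Generators of the Jacobian syzygies of `X 1 * f0`. -/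
def yfSyz : Fin 4 → Fin 3 → S3 :=
  ![![form 6 [(-170000000, 4, 2), (31113216, 4, 1), (9712440, 3, 3), (4745448, 3, 2),
       (-309247232, 3, 1), (31113216, 3, 0), (62281251, 2, 2), (-83908056, 2, 1), (-3559040,
       2, 0), (6165288, 1, 2), (-32209815, 1, 1), (-35650560, 1, 0), (3135429, 0, 1)],
     form 6 [(204000000, 3, 3), (-25927680, 3, 2), (-11654928, 2, 4), (-12003768, 2, 3),
       (443770880, 2, 2), (-25927680, 2, 1), (-87037875, 1, 3), (40409544, 1, 2), (142542080,
       1, 1), (-6840936, 0, 3), (1045143, 0, 2)],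
     form 6 [(-7130112, 4, 2), (3943269, 3, 3), (-20400000, 3, 2), (-11667456, 3, 1),
       (2280312, 2, 3), (9939186, 2, 2), (-55072256, 2, 1), (-4537344, 2, 0), (16219224, 1,
       2), (3027309, 1, 1), (-15442560, 1, 0), (1520208, 0, 2)]],
    ![form 6 [(90956800, 4, 2), (-33030144, 4, 1), (-1214055, 3, 3), (-20484864, 3, 2),
       (235202560, 3, 1), (-33030144, 3, 0), (-6157026, 2, 2), (9178368, 2, 1), (197632, 2,
       0), (-770661, 1, 2), (1243941, 1, 1), (37847040, 1, 0)],
     form 6 [(-109148160, 3, 3), (27525120, 3, 2), (1456866, 2, 4), (25615872, 2, 3),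
       (-327884800, 2, 2), (27525120, 2, 1), (9202032, 1, 3), (23683584, 1, 2), (-115517440,
       1, 1), (855117, 0, 3), (-950130, 0, 2)],
     form 6 [(7569408, 4, 2), (-646272, 3, 3), (10914816, 3, 2), (12386304, 3, 1), (-285039,
       2, 3), (-4758912, 2, 2), (44142592, 2, 1), (4816896, 2, 0), (-1915866, 1, 2),
       (-6332160, 1, 1), (12813312, 1, 0), (-190026, 0, 2), (95013, 0, 1)]],
    ![form 6 [(-1484199790, 4, 2), (569180160, 4, 1), (19424880, 3, 3), (337470264, 3, 2),
       (-3969272476, 3, 1), (569180160, 3, 0), (98512416, 2, 2), (-102912135, 2, 1),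
       (-2814766, 2, 0), (12330576, 1, 2), (-13737768, 1, 1), (-653230743, 1, 0), (3135429,
       0, 0)],
     form 6 [(1781039748, 3, 3), (-474316800, 3, 2), (-23309856, 2, 4), (-421508880, 2, 3),
       (5519348776, 2, 2), (-474316800, 2, 1), (-147232512, 1, 3), (-445625913, 1, 2),
       (1959621028, 1, 1), (-13681872, 0, 3), (8361144, 0, 2), (1045143, 0, 1)],
     form 6 [(-130437120, 4, 2), (10340352, 3, 3), (-177476889, 3, 2), (-213442560, 3, 1),
       (4560624, 2, 3), (78422904, 2, 2), (-746336386, 2, 1), (-83005440, 2, 0), (30653856,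
       1, 2), (113011716, 1, 1), (-217074537, 1, 0), (3040416, 0, 2)]],
    ![form 6 [(187544000, 4, 2), (-71147520, 4, 1), (-2428110, 3, 3), (-42183783, 3, 2),
       (497916800, 3, 1), (-71147520, 3, 0), (-12314052, 2, 2), (15773790, 2, 1), (90560, 2,
       0), (-1541322, 1, 2), (1717221, 1, 1), (81618213, 1, 0)],
     form 6 [(-225052800, 3, 3), (59289600, 3, 2), (2913732, 2, 4), (52688610, 2, 3),
       (-692864000, 2, 2), (59289600, 2, 1), (18404064, 1, 3), (52603440, 1, 2), (-245475200,
       1, 1), (1710234, 0, 3), (-1045143, 0, 2), (-950130, 0, 1)],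
     form 6 [(16304640, 4, 2), (-1292544, 3, 3), (22505280, 3, 2), (26680320, 3, 1),
       (-570078, 2, 3), (-9802863, 2, 2), (93743360, 2, 1), (10375680, 2, 0), (-3831732, 1,
       2), (-13698906, 1, 1), (27264960, 1, 0), (-380052, 0, 2), (95013, 0, 0)]]]

/-- The first relation between the syzygies `yfSyz`. -/
def yfLeft : Fin 4 → S3 :=
  ![form 1 [(-468736, 1, 0), (95013, 0, 0)],
    form 1 [(-15088854, 1, 0), (-1520208, 0, 1)],
    form 1 [(1080320, 1, 0), (-95013, 0, 1)],
    form 1 [(15442560, 1, 0)]]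

/-- The second relation between the syzygies `yfSyz`. -/
def yfRight : Fin 4 → S3 :=
  ![form 1 [(25415168, 1, 0), (-8108424, 0, 0)],
    form 1 [(467906352, 1, 0), (110190294, 0, 1), (-9772245, 0, 0)],
    form 1 [(25763840, 1, 0), (8108424, 0, 1)],
    form 1 [(9772245, 0, 1)]]

theorem intCast_mul_X_one_mul_f0 : ((3 : ℤ) : S3) * (X 1 * f0) = form 11 yfTerms := by
  have hf := three_mul_f0
  simp only [yfTerms, form_cons, form_nil] at hf ⊢
  push_cast at hf ⊢
  linear_combination (X 1) * hf

set_option maxHeartbeats 2000000 in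
theorem isJacobianResolution_X_one_mul_f0 :
    IsJacobianResolution (X 1 * f0) yfSyz yfLeft yfRight := by
  refine isJacobianResolution_of_certificate (N := 3) (α := 40215) (β := -4301) (K := 561)
    (i := 0) (j := 2) (k := 13) (by norm_num) (by norm_num) (by norm_num)
    (intCast_mul_pderiv intCast_mul_X_one_mul_f0) (fun l => ?_) (fun l => ?_) ?_ (fun l => ?_) (fun k => ?_)
    (fun k => ?_) (by norm_num)
    (A := ![form 5 [(144, 3, 1), (-1038, 2, 1), (144, 2, 0), (-2, 1, 0), (-165, 0, 0)],
      form 5 [(-120, 2, 2), (1305, 1, 2), (-120, 1, 1), (515, 0, 1)],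
      form 5 [(-33, 3, 2), (-54, 2, 1), (-180, 1, 1), (-21, 1, 0), (-57, 0, 0)]]) ?_
  · fin_cases l <;>
      · simp [yfSyz, yfLeft, form_cons, form_nil]
        ring
  · fin_cases l <;>
      · simp [yfSyz, yfRight, form_cons, form_nil]
        ring
  · refine fun h => ?_
    have := congrArg (eval ![0, 1, 0]) h
    simp [minorTwo, yfLeft, yfRight, form_cons, form_nil] at this
  · fin_cases l <;>
      · simp only [wedge, minorTwo, yfSyz, yfLeft, yfRight, formGradient, yfTerms, form_cons, form_nil, List.map_cons,
          List.map_nil, Fin.zero_eta, Fin.mk_one, Fin.reduceFinMk, Fin.isValue, Fin.reduceAdd,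
          zero_add, Matrix.cons_val, Nat.reduceSub, Nat.cast_ofNat, Int.reduceMul, Int.reduceNeg]
        push_cast
        ring
  · fin_cases k
    · refine ⟨85684167160753029120, by norm_num, ?_⟩
      set I := minorIdeal yfLeft yfRight
      convert add_mem (add_mem (add_mem (add_mem (I.mul_mem_left (form 0 [(1153421, 0, 0)])
          (minorTwo_mem _ _ 0 2)) (I.mul_mem_left (form 0 [(203840, 0, 0)]) (minorTwo_mem
          _ _ 0 3))) (I.mul_mem_left (form 0 [(203840, 0, 0)]) (minorTwo_mem _ _ 1 2)))
          (I.mul_mem_left (form 0 [(-269056, 0, 0)]) (minorTwo_mem _ _ 1 3)))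
          (I.mul_mem_left (form 0 [(3897216, 0, 0)]) (minorTwo_mem _ _ 2 3)) using 1
      simp [minorTwo, yfLeft, yfRight, form_cons, form_nil]
      ring
    · refine ⟨14490019843171110, by norm_num, ?_⟩
      set I := minorIdeal yfLeft yfRight
      convert add_mem (add_mem (add_mem (add_mem (I.mul_mem_left (form 0 [(3856613, 0, 0)])
          (minorTwo_mem _ _ 0 2)) (I.mul_mem_left (form 0 [(-353920, 0, 0)]) (minorTwo_mem
          _ _ 0 3))) (I.mul_mem_left (form 0 [(-353920, 0, 0)]) (minorTwo_mem _ _ 1 2)))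
          (I.mul_mem_left (form 0 [(32000, 0, 0)]) (minorTwo_mem _ _ 1 3)))
          (I.mul_mem_left (form 0 [(180234, 0, 0)]) (minorTwo_mem _ _ 2 3)) using 1
      simp [minorTwo, yfLeft, yfRight, form_cons, form_nil]
      ring
    · refine ⟨20333254511780259840, by norm_num, ?_⟩
      set I := minorIdeal yfLeft yfRight
      convert add_mem (add_mem (add_mem (add_mem (add_mem (I.mul_mem_left (form 0 [(-21899264,
          0, 0)]) (minorTwo_mem _ _ 0 1)) (I.mul_mem_left (form 0 [(360383883, 0, 0)])
          (minorTwo_mem _ _ 0 2))) (I.mul_mem_left (form 0 [(-44721120, 0, 0)])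
          (minorTwo_mem _ _ 0 3))) (I.mul_mem_left (form 0 [(-922592, 0, 0)])
          (minorTwo_mem _ _ 1 2))) (I.mul_mem_left (form 0 [(-231680, 0, 0)])
          (minorTwo_mem _ _ 1 3))) (I.mul_mem_left (form 0 [(5552064, 0, 0)])
          (minorTwo_mem _ _ 2 3)) using 1
      simp [minorTwo, yfLeft, yfRight, form_cons, form_nil]
      ring
  · fin_cases k
    · refine ⟨0, not_X_dvd_of_eval_ne_zero (x := ![0, 1, 1]) rfl ?_⟩
      simp [formGradient, yfTerms, form_cons, form_nil]
      norm_num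
    · refine ⟨1, not_X_dvd_of_eval_ne_zero (x := ![0, 0, 1]) rfl ?_⟩
      simp [formGradient, yfTerms, form_cons, form_nil]
    · refine ⟨0, not_X_dvd_of_eval_ne_zero (x := ![1, 1, 0]) rfl ?_⟩
      simp [formGradient, yfTerms, form_cons, form_nil]
  · simp [formGradient, yfTerms, form_cons, form_nil]
    ring

/-- The terms of `3 * X 0 * X 1 * X 2 * f0`. -/
def xyzfTerms : List (ℤ × ℕ × ℕ) :=
  [(3, 7, 5), (12, 6, 4), (9, 5, 4), (18, 5, 3), (19, 4, 3), (12, 4, 2), (9, 3, 3), (11, 3, 2),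
    (3, 3, 1), (6, 2, 2), (1, 2, 1), (3, 1, 2), (-3, 1, 1)]

/-- Generators of the Jacobian syzygies of `X 0 * X 1 * X 2 * f0`. -/
def xyzfSyz : Fin 4 → Fin 3 → S3 :=
  ![![form 7 [(213691392, 5, 2), (22437, 4, 3), (-99268416, 4, 2), (221605888, 4, 1),
       (1275264, 3, 3), (22385214, 3, 2), (51387648, 3, 1), (7914496, 3, 0), (6476274, 2, 2),
       (-10376919, 2, 1), (-3676608, 2, 0), (808704, 1, 2), (-1213056, 1, 1)],
     form 7 [(-300750848, 4, 3), (-172368, 3, 4), (139711104, 3, 3), (-395724800, 3, 2),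
       (-1824768, 2, 4), (-33258348, 2, 3), (29497728, 2, 2), (-94973952, 2, 1), (-11468952,
       1, 3), (-28541676, 1, 2), (44119296, 1, 1), (-1078272, 0, 3), (1213056, 0, 2)],
     form 7 [(7914496, 4, 2), (704781, 3, 3), (-3676608, 3, 2), (15828992, 3, 1), (196992, 2,
       3), (3357270, 2, 2), (-7353216, 2, 1), (7914496, 2, 0), (1511379, 1, 2), (7846377, 1,
       1), (-3676608, 1, 0), (134784, 0, 2)]],
    ![form 7 [(1560960, 5, 2), (14391, 4, 3), (-575424, 4, 2), (1630976, 4, 1), (170730, 3,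
       2), (480000, 3, 1), (70016, 3, 0), (9126, 2, 2), (36963, 2, 1), (-19776, 2, 0),
       (29952, 1, 1), (-14976, 1, 0)],
     form 7 [(-2196352, 4, 3), (-20592, 3, 4), (809856, 3, 3), (-2901760, 3, 2), (-251172, 2,
       3), (15744, 2, 2), (-705408, 2, 1), (-12168, 1, 3), (-313764, 1, 2), (287232, 1, 1),
       (-14976, 0, 2), (14976, 0, 1)],
     form 7 [(55040, 4, 2), (2223, 3, 3), (-21312, 3, 2), (110080, 3, 1), (18162, 2, 2),
       (-49152, 2, 1), (55040, 2, 0), (1521, 1, 2), (54435, 1, 1), (-24768, 1, 0)]],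
    ![form 7 [(-857088, 5, 2), (-9963, 4, 3), (347328, 4, 2), (-888832, 4, 1), (-107298, 3,
       2), (-258816, 3, 1), (-31744, 3, 0), (-6318, 2, 2), (-2727, 2, 1), (12864, 2, 0),
       (-13824, 1, 1)],
     form 7 [(1206272, 4, 3), (14256, 3, 4), (-488832, 3, 3), (1587200, 3, 2), (158292, 2,
       3), (-24192, 2, 2), (380928, 2, 1), (8424, 1, 3), (162516, 1, 2), (-154368, 1, 1),
       (1152, 0, 2)],
     form 7 [(-31744, 4, 2), (-1539, 3, 3), (12864, 3, 2), (-63488, 3, 1), (-10890, 2, 2),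
       (25728, 2, 1), (-31744, 2, 0), (-1053, 1, 2), (-30183, 1, 1), (12864, 1, 0), (1152, 0,
       1)]],
    ![form 7 [(-2474496, 5, 2), (-14391, 4, 3), (575424, 4, 2), (-2419712, 4, 1), (-170730, 3,
       2), (-1797888, 3, 1), (54784, 3, 0), (-9126, 2, 2), (-36963, 2, 1), (39744, 2, 0),
       (-29952, 1, 1), (-164736, 1, 0)],
     form 7 [(3489280, 4, 3), (20592, 3, 4), (-809856, 3, 3), (4449280, 3, 2), (251172, 2,
       3), (1651584, 2, 2), (960000, 2, 1), (12168, 1, 3), (313764, 1, 2), (122112, 1, 1),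
       (14976, 0, 2)],
     form 7 [(-124928, 4, 2), (-2223, 3, 3), (21312, 3, 2), (-249856, 3, 1), (-18162, 2, 2),
       (-35712, 2, 1), (-124928, 2, 0), (-1521, 1, 2), (-54435, 1, 1), (-20160, 1, 0),
       (14976, 0, 0)]]]

/-- The first relation between the syzygies `xyzfSyz`. -/
def xyzfLeft : Fin 4 → S3 :=
  ![form 1 [(-1805, 1, 0), (384, 0, 0)],
    form 1 [(-1131264, 1, 0), (-31104, 0, 1)],
    form 1 [(-2782499, 1, 0), (-44928, 0, 1)],
    form 1 [(94272, 1, 0)]]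

/-- The second relation between the syzygies `xyzfSyz`. -/
def xyzfRight : Fin 4 → S3 :=
  ![form 1 [(496, 1, 0), (-201, 0, 0)],
    form 1 [(20700, 0, 1)],
    form 1 [(123664, 1, 0), (23517, 0, 1), (-57447, 0, 0)],
    form 1 [(4419, 0, 1)]]

theorem intCast_mul_X_mul_X_mul_X_mul_f0 : ((3 : ℤ) : S3) * (X 0 * X 1 * X 2 * f0) = form 13 xyzfTerms := by
  have hf := three_mul_f0
  simp only [xyzfTerms, form_cons, form_nil] at hf ⊢
  push_cast at hf ⊢
  linear_combination (X 0 * X 1 * X 2) * hf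

set_option maxHeartbeats 2000000 in
theorem isJacobianResolution_X_mul_X_mul_X_mul_f0 :
    IsJacobianResolution (X 0 * X 1 * X 2 * f0) xyzfSyz xyzfLeft xyzfRight := by
  refine isJacobianResolution_of_certificate (N := 3) (α := 491) (β := -1664) (K := 39)
    (i := 1) (j := 2) (k := 15) (by norm_num) (by norm_num) (by norm_num)
    (intCast_mul_pderiv intCast_mul_X_mul_X_mul_X_mul_f0) (fun l => ?_) (fun l => ?_) ?_ (fun l => ?_) (fun k => ?_)
    (fun k => ?_) (by norm_num)
    (A := ![form 6 [(54, 4, 2), (56, 3, 1), (12, 2, 1), (2, 2, 0), (-1, 1, 0)],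
      form 6 [(-76, 3, 3), (-100, 2, 2), (-1, 1, 2), (-24, 1, 1), (12, 0, 1)],
      form 6 [(2, 3, 2), (4, 2, 1), (-1, 1, 1), (2, 1, 0), (-1, 0, 0)]]) ?_
  · fin_cases l <;>
      · simp [xyzfSyz, xyzfLeft, form_cons, form_nil]
        ring
  · fin_cases l <;>
      · simp [xyzfSyz, xyzfRight, form_cons, form_nil]
        ring
  · refine fun h => ?_
    have := congrArg (eval ![0, 1, 0]) h
    simp [minorTwo, xyzfLeft, xyzfRight, form_cons, form_nil] at this
  · fin_cases l <;>
      · simp only [wedge, minorTwo, xyzfSyz, xyzfLeft, xyzfRight, formGradient, xyzfTerms, form_cons, form_nil, List.map_cons,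
          List.map_nil, Fin.zero_eta, Fin.mk_one, Fin.reduceFinMk, Fin.isValue, Fin.reduceAdd,
          zero_add, Matrix.cons_val, Nat.reduceSub, Nat.cast_ofNat, Int.reduceMul, Int.reduceNeg]
        push_cast
        ring
  · fin_cases k
    · refine ⟨1521520081895424, by norm_num, ?_⟩
      set I := minorIdeal xyzfLeft xyzfRight
      convert add_mem (add_mem (add_mem (add_mem (I.mul_mem_left (form 0 [(15308853, 0, 0)])
          (minorTwo_mem _ _ 0 1)) (I.mul_mem_left (form 0 [(-71205252, 0, 0)])
          (minorTwo_mem _ _ 0 3))) (I.mul_mem_left (form 0 [(53083, 0, 0)]) (minorTwo_mem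
          _ _ 1 2))) (I.mul_mem_left (form 0 [(-291525, 0, 0)]) (minorTwo_mem _ _ 1 3)))
          (I.mul_mem_left (form 0 [(254908, 0, 0)]) (minorTwo_mem _ _ 2 3)) using 1
      simp [minorTwo, xyzfLeft, xyzfRight, form_cons, form_nil]
      ring
    · refine ⟨4764883968, by norm_num, ?_⟩
      set I := minorIdeal xyzfLeft xyzfRight
      convert add_mem (add_mem (add_mem (add_mem (I.mul_mem_left (form 0 [(243, 0, 0)])
          (minorTwo_mem _ _ 0 1)) (I.mul_mem_left (form 0 [(2916, 0, 0)]) (minorTwo_mem _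
          _ 0 3))) (I.mul_mem_left (form 0 [(-3, 0, 0)]) (minorTwo_mem _ _ 1 2)))
          (I.mul_mem_left (form 0 [(-91, 0, 0)]) (minorTwo_mem _ _ 1 3))) (I.mul_mem_left
          (form 0 [(36, 0, 0)]) (minorTwo_mem _ _ 2 3)) using 1
      simp [minorTwo, xyzfLeft, xyzfRight, form_cons, form_nil]
      ring
    · refine ⟨26745470189568, by norm_num, ?_⟩
      set I := minorIdeal xyzfLeft xyzfRight
      convert add_mem (add_mem (add_mem (add_mem (add_mem (I.mul_mem_left (form 0 [(3832929, 0,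
          0)]) (minorTwo_mem _ _ 0 1)) (I.mul_mem_left (form 0 [(-1212416, 0, 0)])
          (minorTwo_mem _ _ 0 2))) (I.mul_mem_left (form 0 [(-10554228, 0, 0)])
          (minorTwo_mem _ _ 0 3))) (I.mul_mem_left (form 0 [(6383, 0, 0)]) (minorTwo_mem _
          _ 1 2))) (I.mul_mem_left (form 0 [(-33969, 0, 0)]) (minorTwo_mem _ _ 1 3)))
          (I.mul_mem_left (form 0 [(29900, 0, 0)]) (minorTwo_mem _ _ 2 3)) using 1
      simp [minorTwo, xyzfLeft, xyzfRight, form_cons, form_nil]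
      ring
  · fin_cases k
    · refine ⟨0, not_X_dvd_of_eval_ne_zero (x := ![0, 1, -1]) rfl ?_⟩
      simp [formGradient, xyzfTerms, form_cons, form_nil]
      norm_num
    · refine ⟨1, not_X_dvd_of_eval_ne_zero (x := ![1, 0, 1]) rfl ?_⟩
      simp [formGradient, xyzfTerms, form_cons, form_nil]
    · refine ⟨2, not_X_dvd_of_eval_ne_zero (x := ![1, 1, 0]) rfl ?_⟩
      simp [formGradient, xyzfTerms, form_cons, form_nil]
  · simp [formGradient, xyzfTerms, form_cons, form_nil]
    ring

theorem nine_mul_f0' : (9 : S3) * f0' = form 10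
    [(9, 6, 4), (36, 5, 3), (27, 4, 3), (54, 4, 2), (65, 3, 2), (36, 3, 1), (27, 2, 2), (49,
      2, 1), (9, 2, 0), (30, 1, 1), (11, 1, 0), (9, 0, 1), (3, 0, 0)] := by
  have hC : ∀ n k : ℕ, k ≠ 0 → (k : S3) * C ((n : ℂ) / k) = (n : S3) := fun n k hk => by
    rw [← map_natCast (C : ℂ →+* S3), ← C_mul, mul_div_cancel₀ _ (Nat.cast_ne_zero.2 hk),
      map_natCast]
  have h65 := hC 65 9 (by norm_num)
  have h49 := hC 49 9 (by norm_num)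
  have h10 := hC 10 3 (by norm_num)
  have h11 := hC 11 9 (by norm_num)
  have h1 := hC 1 3 (by norm_num)
  simp only [f0', form_cons, form_nil]
  push_cast at h65 h49 h10 h11 h1 ⊢
  linear_combination X 0 ^ 3 * X 1 ^ 2 * X 2 ^ 5 * h65 + X 0 ^ 2 * X 1 * X 2 ^ 7 * h49 +
    3 * X 0 * X 1 * X 2 ^ 8 * h10 + X 0 * X 2 ^ 9 * h11 + 3 * X 2 ^ 10 * h1

/-- The terms of `9 * X 0 * f0'`. -/
def xfTerms' : List (ℤ × ℕ × ℕ) :=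
  [(9, 7, 4), (36, 6, 3), (27, 5, 3), (54, 5, 2), (65, 4, 2), (36, 4, 1), (27, 3, 2), (49, 3,
    1), (9, 3, 0), (30, 2, 1), (11, 2, 0), (9, 1, 1), (3, 1, 0)]

/-- Generators of the Jacobian syzygies of `X 0 * f0'`. -/
def xfSyz' : Fin 4 → Fin 3 → S3 :=
  ![![form 5 [(-1638400, 4, 1), (-54756, 3, 2), (-409600, 3, 1), (-1638400, 3, 0), (210204, 2,
       1), (-1638400, 2, 0), (-89505, 1, 1), (-675840, 1, 0)],
     form 5 [(2867200, 3, 2), (95823, 2, 3), (564736, 2, 2), (3768320, 2, 1), (-481014, 1,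
       2), (2264576, 1, 1), (901120, 1, 0), (165321, 0, 2), (733755, 0, 1), (225280, 0, 0)],
     form 5 [(76032, 3, 2), (163840, 3, 1), (-8424, 2, 2), (116992, 2, 1), (163840, 2, 0),
       (60120, 1, 1), (163840, 1, 0), (-8424, 0, 1)]],
    ![form 5 [(-4259840, 4, 1), (-492804, 3, 2), (-1769472, 3, 1), (-4259840, 3, 0), (1891836,
       2, 1), (-4964352, 2, 0), (-805545, 1, 1), (-2949120, 1, 0)],
     form 5 [(7454720, 3, 2), (862407, 2, 3), (1728000, 2, 2), (9797632, 2, 1), (-4329126, 1,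
       2), (5561856, 1, 1), (2342912, 1, 0), (1487889, 0, 2), (816147, 0, 1)],
     form 5 [(684288, 3, 2), (425984, 3, 1), (-75816, 2, 2), (1347840, 2, 1), (425984, 2, 0),
       (541080, 1, 1), (983040, 1, 0), (-75816, 0, 1), (294912, 0, 0)]],
    0,
    0]

/-- The first relation between the syzygies `xfSyz'`. -/
def xfLeft' : Fin 4 → S3 :=
  ![0, 0, 1, 0]

/-- The second relation between the syzygies `xfSyz'`. -/
def xfRight' : Fin 4 → S3 :=
  ![0, 0, 0, 1]

theorem intCast_mul_X_zero_mul_f0' : ((9 : ℤ) : S3) * (X 0 * f0') = form 11 xfTerms' := by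
  have hf := nine_mul_f0'
  simp only [xfTerms', form_cons, form_nil] at hf ⊢
  push_cast at hf ⊢
  linear_combination (X 0) * hf

set_option maxHeartbeats 2000000 in
theorem isJacobianResolution_X_zero_mul_f0' :
    IsJacobianResolution (X 0 * f0') xfSyz' xfLeft' xfRight' := by
  refine isJacobianResolution_of_certificate (N := 9) (α := 1) (β := 22145925120) (K := 9504)
    (i := 1) (j := 0) (k := 13) (by norm_num) (by norm_num) (by norm_num)
    (intCast_mul_pderiv intCast_mul_X_zero_mul_f0') (fun l => ?_) (fun l => ?_) ?_ (fun l => ?_) (fun k => ?_)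
    (fun k => ?_) (by norm_num)
    (A := ![form 4 [(4212, 3, 1), (40960, 3, 0), (26100, 2, 0), (6885, 1, 0)],
      form 4 [(-7371, 2, 2), (-71680, 2, 1), (-50130, 1, 1), (-22528, 1, 0), (-12717, 0, 1),
        (-3399, 0, 0)],
      form 4 [(648, 2, 1), (-4096, 2, 0), (360, 1, 0), (648, 0, 0)]]) ?_
  · fin_cases l <;> simp [xfSyz', xfLeft', form_cons, form_nil]
  · fin_cases l <;> simp [xfSyz', xfRight', form_cons, form_nil]
  · refine fun h => ?_
    have := congrArg (eval ![0, 0, 0]) h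
    simp [minorTwo, xfLeft', xfRight'] at this
  · fin_cases l <;>
      · simp only [wedge, minorTwo, xfSyz', xfLeft', xfRight', formGradient, xfTerms', form_cons, form_nil, List.map_cons,
          List.map_nil, Fin.zero_eta, Fin.mk_one, Fin.reduceFinMk, Fin.isValue, Fin.reduceAdd,
          zero_add, Matrix.cons_val, Nat.reduceSub, Nat.cast_ofNat, Int.reduceMul, Int.reduceNeg]
        push_cast
        ring
  · fin_cases k
    · refine ⟨1, by norm_num, ?_⟩
      set I := minorIdeal xfLeft' xfRight'
      convert I.mul_mem_left (form 2 [(1, 2, 0)]) (minorTwo_mem _ _ 2 3) using 1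
      simp [minorTwo, xfLeft', xfRight', form_cons, form_nil]
    · refine ⟨1, by norm_num, ?_⟩
      set I := minorIdeal xfLeft' xfRight'
      convert I.mul_mem_left (form 2 [(1, 0, 2)]) (minorTwo_mem _ _ 2 3) using 1
      simp [minorTwo, xfLeft', xfRight', form_cons, form_nil]
    · refine ⟨1, by norm_num, ?_⟩
      set I := minorIdeal xfLeft' xfRight'
      convert I.mul_mem_left (form 2 [(1, 0, 0)]) (minorTwo_mem _ _ 2 3) using 1
      simp [minorTwo, xfLeft', xfRight', form_cons, form_nil]
  · fin_cases k
    · refine ⟨0, not_X_dvd_of_eval_ne_zero (x := ![0, 0, 1]) rfl ?_⟩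
      simp [formGradient, xfTerms', form_cons, form_nil]
    · refine ⟨0, not_X_dvd_of_eval_ne_zero (x := ![0, 0, 1]) rfl ?_⟩
      simp [formGradient, xfTerms', form_cons, form_nil]
    · refine ⟨0, not_X_dvd_of_eval_ne_zero (x := ![1, 1, 0]) rfl ?_⟩
      simp [formGradient, xfTerms', form_cons, form_nil]
  · simp [formGradient, xfTerms', form_cons, form_nil]
    ring

/-- The terms of `9 * X 1 * f0'`. -/
def yfTerms' : List (ℤ × ℕ × ℕ) :=
  [(9, 6, 5), (36, 5, 4), (27, 4, 4), (54, 4, 3), (65, 3, 3), (36, 3, 2), (27, 2, 3), (49, 2,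
    2), (9, 2, 1), (30, 1, 2), (11, 1, 1), (9, 0, 2), (3, 0, 1)]

/-- Generators of the Jacobian syzygies of `X 1 * f0'`. -/
def yfSyz' : Fin 4 → Fin 3 → S3 :=
  ![![form 5 [(5265, 3, 2), (-27648, 3, 1), (27366, 2, 1), (-27648, 2, 0), (8667, 1, 1),
       (-34475, 1, 0), (-10560, 0, 0)],
     form 5 [(-6318, 2, 3), (23040, 2, 2), (-47808, 1, 2), (23040, 1, 1), (-10935, 0, 2),
       (-3730, 0, 1)],
     form 5 [(6336, 3, 2), (1701, 2, 2), (10368, 2, 1), (15354, 1, 1), (4032, 1, 0), (2430,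
       0, 1), (4245, 0, 0)]],
    ![form 6 [(335662080, 4, 2), (92012544, 4, 1), (36960300, 3, 3), (158925240, 3, 2),
       (276237312, 3, 1), (92012544, 3, 0), (-183254805, 2, 2), (384373944, 2, 1),
       (128860160, 2, 0), (60842340, 1, 2), (243838485, 1, 1), (35143680, 1, 0), (7818525, 0,
       1)],
     form 6 [(-402794496, 3, 3), (-76677120, 3, 2), (-44352360, 2, 4), (-110584440, 2, 3),
       (-405989376, 2, 2), (-76677120, 2, 1), (285028065, 1, 3), (-286103160, 1, 2),
       (-128860160, 1, 1), (-76763700, 0, 3), (-28667925, 0, 2)],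
     form 6 [(-21086208, 4, 2), (-50078655, 3, 3), (36721152, 3, 2), (-34504704, 3, 1),
       (11941020, 2, 3), (-75986910, 2, 2), (5411328, 2, 1), (-13418496, 2, 0), (-84768120,
       1, 2), (-12804255, 1, 1), (17058600, 0, 2)]],
    ![form 6 [(-38433308160, 4, 2), (-10535436288, 4, 1), (-5229882450, 3, 3), (-16850582685,
       3, 2), (-31629172224, 3, 1), (-10535436288, 3, 0), (20863139220, 2, 2), (-42597409518,
       2, 1), (-14754488320, 2, 0), (-8609191110, 1, 2), (-26509265145, 1, 1), (-3956901585,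
       1, 0)],
     form 6 [(46119969792, 3, 3), (8779530240, 3, 2), (6275858940, 2, 4), (10925331030, 2,
       3), (46485783552, 2, 2), (8779530240, 2, 1), (-31952828160, 1, 3), (30351726720, 1,
       2), (14754488320, 1, 1), (10862063550, 0, 3), (2212642575, 0, 2), (-670497750, 0, 1)],
     form 6 [(2414370816, 4, 2), (5809605120, 3, 3), (-4204571904, 3, 2), (3950788608, 3, 1),
       (-1689654330, 2, 3), (9025358175, 2, 2), (-619597056, 2, 1), (1536417792, 2, 0),
       (9395220780, 1, 2), (1782394830, 1, 1), (-2413791900, 0, 2), (67049775, 0, 0)]],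
    0]

/-- The first relation between the syzygies `yfSyz'`. -/
def yfLeft' : Fin 4 → S3 :=
  ![form 2 [(-31726080, 1, 1), (-258785280, 1, 0), (345436650, 0, 2), (-57572775, 0, 1)],
    form 1 [(1875968, 1, 0), (466560, 0, 1), (-77760, 0, 0)],
    form 1 [(16384, 1, 0), (3645, 0, 1)],
    0]

/-- The second relation between the syzygies `yfSyz'`. -/
def yfRight' : Fin 4 → S3 :=
  ![0, 0, 0, 1]

theorem intCast_mul_X_one_mul_f0' : ((9 : ℤ) : S3) * (X 1 * f0') = form 11 yfTerms' := by
  have hf := nine_mul_f0'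
  simp only [yfTerms', form_cons, form_nil] at hf ⊢
  push_cast at hf ⊢
  linear_combination (X 1) * hf

set_option maxHeartbeats 2000000 in
theorem isJacobianResolution_X_one_mul_f0' :
    IsJacobianResolution (X 1 * f0') yfSyz' yfLeft' yfRight' := by
  refine isJacobianResolution_of_certificate (N := 9) (α := 1) (β := 3035175) (K := 420255)
    (i := 0) (j := 2) (k := 13) (by norm_num) (by norm_num) (by norm_num)
    (intCast_mul_pderiv intCast_mul_X_one_mul_f0') (fun l => ?_) (fun l => ?_) ?_ (fun l => ?_) (fun k => ?_)
    (fun k => ?_) (by norm_num)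
    (A := ![form 5 [(215865, 3, 2), (2352992, 3, 1), (1372461, 2, 1), (179552, 2, 0), (355347, 1,
        1), (124630, 1, 0), (33990, 0, 0)],
      form 5 [(-259038, 2, 3), (-2790960, 2, 2), (-1756368, 1, 2), (-979760, 1, 1),
        (-448335, 0, 2), (-124630, 0, 1)],
      form 5 [(-20394, 3, 2), (69741, 2, 2), (238308, 2, 1), (272934, 1, 1), (77582, 1, 0),
        (99630, 0, 1)]]) ?_
  · fin_cases l <;>
      · simp [yfSyz', yfLeft', form_cons, form_nil]
        ring
  · fin_cases l <;> simp [yfSyz', yfRight', form_cons, form_nil]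
  · refine fun h => ?_
    have := congrArg (eval ![0, 1, 0]) h
    simp [minorTwo, yfLeft', yfRight', form_cons, form_nil] at this
  · fin_cases l <;>
      · simp only [wedge, minorTwo, yfSyz', yfLeft', yfRight', formGradient, yfTerms', form_cons, form_nil, List.map_cons,
          List.map_nil, Fin.zero_eta, Fin.mk_one, Fin.reduceFinMk, Fin.isValue, Fin.reduceAdd,
          zero_add, Matrix.cons_val, Nat.reduceSub, Nat.cast_ofNat, Int.reduceMul, Int.reduceNeg]
        push_cast
        ring
  · fin_cases k
    · refine ⟨455803404288, by norm_num, ?_⟩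
      set I := minorIdeal yfLeft' yfRight'
      convert add_mem (add_mem (I.mul_mem_left (form 0 [(64, 0, 0)]) (minorTwo_mem _ _ 0 3))
          (I.mul_mem_left (form 1 [(-212992, 1, 0), (-47385, 0, 1)]) (minorTwo_mem _ _ 1
          3))) (I.mul_mem_left (form 1 [(52207616, 1, 0)]) (minorTwo_mem _ _ 2 3)) using 1
      simp [minorTwo, yfLeft', yfRight', form_cons, form_nil]
      ring
    · refine ⟨22559670450, by norm_num, ?_⟩
      set I := minorIdeal yfLeft' yfRight'
      convert add_mem (add_mem (I.mul_mem_left (form 0 [(64, 0, 0)]) (minorTwo_mem _ _ 0 3))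
          (I.mul_mem_left (form 1 [(-212992, 1, 0), (-47385, 0, 1)]) (minorTwo_mem _ _ 1
          3))) (I.mul_mem_left (form 1 [(24387584, 1, 0), (6189210, 0, 1)]) (minorTwo_mem
          _ _ 2 3)) using 1
      simp [minorTwo, yfLeft', yfRight', form_cons, form_nil]
      ring
    · refine ⟨13689542246400, by norm_num, ?_⟩
      set I := minorIdeal yfLeft' yfRight'
      convert add_mem (add_mem (I.mul_mem_left (form 0 [(15552, 0, 0)]) (minorTwo_mem _ _ 0 3))
          (I.mul_mem_left (form 1 [(-4298948608, 1, 0), (-1067806395, 0, 1), (-176048640,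
          0, 0)]) (minorTwo_mem _ _ 1 3))) (I.mul_mem_left (form 1 [(492229615616, 1, 0),
          (135205355520, 0, 1)]) (minorTwo_mem _ _ 2 3)) using 1
      simp [minorTwo, yfLeft', yfRight', form_cons, form_nil]
      ring
  · fin_cases k
    · refine ⟨0, not_X_dvd_of_eval_ne_zero (x := ![0, 1, 1]) rfl ?_⟩
      simp [formGradient, yfTerms', form_cons, form_nil]
      norm_num
    · refine ⟨1, not_X_dvd_of_eval_ne_zero (x := ![0, 0, 1]) rfl ?_⟩
      simp [formGradient, yfTerms', form_cons, form_nil]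
    · refine ⟨0, not_X_dvd_of_eval_ne_zero (x := ![1, 1, 0]) rfl ?_⟩
      simp [formGradient, yfTerms', form_cons, form_nil]
  · simp [formGradient, yfTerms', form_cons, form_nil]
    ring

/-- The terms of `9 * X 0 * X 1 * X 2 * f0'`. -/
def xyzfTerms' : List (ℤ × ℕ × ℕ) :=
  [(9, 7, 5), (36, 6, 4), (27, 5, 4), (54, 5, 3), (65, 4, 3), (36, 4, 2), (27, 3, 3), (49, 3,
    2), (9, 3, 1), (30, 2, 2), (11, 2, 1), (9, 1, 2), (3, 1, 1)]

/-- Generators of the Jacobian syzygies of `X 0 * X 1 * X 2 * f0'`. -/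
def xyzfSyz' : Fin 4 → Fin 3 → S3 :=
  ![![form 6 [(3456, 4, 2), (621, 3, 2), (3584, 3, 1), (3162, 2, 1), (128, 2, 0), (1026, 1,
       1), (45, 1, 0)],
     form 6 [(-4864, 3, 3), (-900, 2, 3), (-6400, 2, 2), (-3936, 1, 2), (-1536, 1, 1),
       (-1548, 0, 2), (-540, 0, 1)],
     form 6 [(128, 3, 2), (153, 2, 2), (256, 2, 1), (198, 1, 1), (128, 1, 0), (207, 0, 1),
       (45, 0, 0)]],
    ![form 7 [(-569088, 5, 2), (214245, 4, 3), (-718848, 4, 2), (-712192, 4, 1), (31050, 3,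
       2), (-1067776, 3, 1), (-143104, 3, 0), (353970, 2, 2), (-780123, 2, 1), (-183040, 2,
       0), (-299520, 1, 1), (-49920, 1, 0)],
     form 7 [(795392, 4, 3), (-310500, 3, 4), (1015040, 3, 3), (1164800, 3, 2), (-221280, 2,
       3), (1587968, 2, 2), (369408, 2, 1), (-534060, 1, 3), (795204, 1, 2), (366080, 1, 1),
       (149760, 0, 2), (49920, 0, 1)],
     form 7 [(6656, 4, 2), (52785, 3, 3), (-43264, 3, 2), (13312, 3, 1), (81750, 2, 2),
       (-22784, 2, 1), (6656, 2, 0), (71415, 1, 2), (-1371, 1, 1)]],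
    ![form 7 [(5750784, 5, 2), (1257525, 4, 3), (-988416, 4, 2), (5963776, 4, 1), (493290, 3,
       2), (3164928, 3, 1), (212992, 3, 0), (2077650, 2, 2), (-517131, 2, 1), (-1244160, 1,
       1)],
     form 7 [(-8093696, 4, 3), (-1822500, 3, 4), (1347840, 3, 3), (-10649600, 3, 2),
       (-1749600, 2, 3), (-2805504, 2, 2), (-2555904, 2, 1), (-3134700, 1, 3), (-1042812, 1,
       2), (103680, 0, 2)],
     form 7 [(212992, 4, 2), (309825, 3, 3), (179712, 3, 2), (425984, 3, 1), (556470, 2, 2),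
       (179712, 2, 1), (212992, 2, 0), (419175, 1, 2), (591093, 1, 1), (103680, 0, 1)]],
    0]

/-- The first relation between the syzygies `xyzfSyz'`. -/
def xyzfLeft' : Fin 4 → S3 :=
  ![form 2 [(-212992, 2, 0), (-591093, 1, 1), (-103680, 0, 1)],
    form 1 [(-1215, 0, 1)],
    form 1 [(128, 1, 0), (207, 0, 1), (45, 0, 0)],
    0]

/-- The second relation between the syzygies `xyzfSyz'`. -/
def xyzfRight' : Fin 4 → S3 :=
  ![0, 0, 0, 1]

theorem intCast_mul_X_mul_X_mul_X_mul_f0' : ((9 : ℤ) : S3) * (X 0 * X 1 * X 2 * f0') = form 13 xyzfTerms' := by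
  have hf := nine_mul_f0'
  simp only [xyzfTerms', form_cons, form_nil] at hf ⊢
  push_cast at hf ⊢
  linear_combination (X 0 * X 1 * X 2) * hf

set_option maxHeartbeats 2000000 in
theorem isJacobianResolution_X_mul_X_mul_X_mul_f0' :
    IsJacobianResolution (X 0 * X 1 * X 2 * f0') xyzfSyz' xyzfLeft' xyzfRight' := by
  refine isJacobianResolution_of_certificate (N := 9) (α := 1) (β := -16640) (K := 11232)
    (i := 1) (j := 2) (k := 14) (by norm_num) (by norm_num) (by norm_num)
    (intCast_mul_pderiv intCast_mul_X_mul_X_mul_X_mul_f0') (fun l => ?_) (fun l => ?_) ?_ (fun l => ?_) (fun k => ?_)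
    (fun k => ?_) (by norm_num)
    (A := ![form 5 [(5589, 3, 2), (55296, 3, 1), (35370, 2, 1), (2048, 2, 0), (9234, 1, 1), (309,
        1, 0)],
      form 5 [(-8100, 2, 3), (-77824, 2, 2), (-54720, 1, 2), (-24576, 1, 1), (-13932, 0, 2),
        (-3708, 0, 1)],
      form 5 [(1377, 2, 2), (2048, 2, 1), (4950, 1, 1), (2048, 1, 0), (1863, 0, 1), (309, 0,
        0)]]) ?_
  · fin_cases l <;>
      · simp [xyzfSyz', xyzfLeft', form_cons, form_nil]
        ring
  · fin_cases l <;> simp [xyzfSyz', xyzfRight', form_cons, form_nil]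
  · refine fun h => ?_
    have := congrArg (eval ![0, 0, 1]) h
    simp [minorTwo, xyzfLeft', xyzfRight', form_cons, form_nil] at this
  · fin_cases l <;>
      · simp only [wedge, minorTwo, xyzfSyz', xyzfLeft', xyzfRight', formGradient, xyzfTerms', form_cons, form_nil, List.map_cons,
          List.map_nil, Fin.zero_eta, Fin.mk_one, Fin.reduceFinMk, Fin.isValue, Fin.reduceAdd,
          zero_add, Matrix.cons_val, Nat.reduceSub, Nat.cast_ofNat, Int.reduceMul, Int.reduceNeg]
        push_cast
        ring
  · fin_cases k
    · refine ⟨28753920, by norm_num, ?_⟩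
      set I := minorIdeal xyzfLeft' xyzfRight'
      convert add_mem (I.mul_mem_left (form 0 [(-135, 0, 0)]) (minorTwo_mem _ _ 0 3))
          (I.mul_mem_left (form 1 [(65677, 1, 0), (11520, 0, 0)]) (minorTwo_mem _ _ 1 3)) using 1
      simp [minorTwo, xyzfLeft', xyzfRight', form_cons, form_nil]
      ring
    · refine ⟨1215, by norm_num, ?_⟩
      set I := minorIdeal xyzfLeft' xyzfRight'
      convert I.mul_mem_left (form 1 [(-1, 0, 1)]) (minorTwo_mem _ _ 1 3) using 1
      simp [minorTwo, xyzfLeft', xyzfRight', form_cons, form_nil]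
      ring
    · refine ⟨26325, by norm_num, ?_⟩
      set I := minorIdeal xyzfLeft' xyzfRight'
      convert add_mem (add_mem (I.mul_mem_left (form 0 [(-1, 0, 0)]) (minorTwo_mem _ _ 0 3))
          (I.mul_mem_left (form 1 [(203, 1, 0), (185, 0, 0)]) (minorTwo_mem _ _ 1 3)))
          (I.mul_mem_left (form 1 [(-1664, 1, 0), (585, 0, 0)]) (minorTwo_mem _ _ 2 3)) using 1
      simp [minorTwo, xyzfLeft', xyzfRight', form_cons, form_nil]
      ring
  · fin_cases k
    · refine ⟨0, not_X_dvd_of_eval_ne_zero (x := ![0, 1, 1]) rfl ?_⟩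
      simp [formGradient, xyzfTerms', form_cons, form_nil]
      norm_num
    · refine ⟨1, not_X_dvd_of_eval_ne_zero (x := ![1, 0, 1]) rfl ?_⟩
      simp [formGradient, xyzfTerms', form_cons, form_nil]
      norm_num
    · refine ⟨2, not_X_dvd_of_eval_ne_zero (x := ![1, 1, 0]) rfl ?_⟩
      simp [formGradient, xyzfTerms', form_cons, form_nil]
  · simp [formGradient, xyzfTerms', form_cons, form_nil]
    ring

theorem isNearlyFreeWith_X_zero_mul_f0 : IsNearlyFreeWith (X 0 * f0) 11 5 6 := by
  refine ⟨rfl, _, isJacobianResolution_X_zero_mul_f0.isMinGenSyz_castLE (by decide) (fun j hj => ?_)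
    (fun i => ?_) (fun i => ?_) (fun i l => ?_) (by decide)⟩
  · obtain rfl : j = 3 := by omega
    rfl
  · fin_cases i <;> exact constantCoeff_form (by decide) (by decide)
  · fin_cases i <;> exact map_zero _
  · fin_cases i <;> fin_cases l <;> exact isHomogeneous_form (by decide)

theorem isMaxTjurina_X_one_mul_f0 : IsMaxTjurina (X 1 * f0) 11 6 := by
  refine isJacobianResolution_X_one_mul_f0.isMaxTjurina (s := 5) (by decide) (fun j l => ?_)
    (fun j => ?_) (fun j => ?_) ?_ fun h => ?_
  · fin_cases j <;> fin_cases l <;> exact isHomogeneous_form (by decide)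
  · fin_cases j <;> exact isHomogeneous_form (by decide)
  · fin_cases j <;> exact isHomogeneous_form (by decide)
  · refine isHomogeneous_of_intCast_mul (N := 3) (by norm_num) ?_
    rw [intCast_mul_X_one_mul_f0]
    exact isHomogeneous_form (by decide)
  · have := congrArg (eval ![0, 1, 1]) (congrFun h 0)
    simp [yfSyz, form_cons, form_nil] at this

theorem isMaxTjurina_X_mul_X_mul_X_mul_f0 : IsMaxTjurina (X 0 * X 1 * X 2 * f0) 13 7 := by
  refine isJacobianResolution_X_mul_X_mul_X_mul_f0.isMaxTjurina (s := 6) (by decide) (fun j l => ?_)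
    (fun j => ?_) (fun j => ?_) ?_ fun h => ?_
  · fin_cases j <;> fin_cases l <;> exact isHomogeneous_form (by decide)
  · fin_cases j <;> exact isHomogeneous_form (by decide)
  · fin_cases j <;> exact isHomogeneous_form (by decide)
  · refine isHomogeneous_of_intCast_mul (N := 3) (by norm_num) ?_
    rw [intCast_mul_X_mul_X_mul_X_mul_f0]
    exact isHomogeneous_form (by decide)
  · have := congrArg (eval ![1, 0, 1]) (congrFun h 0)
    simp [xyzfSyz, form_cons, form_nil] at this
    norm_num at this

theorem isFreeWith_X_zero_mul_f0' : IsFreeWith (X 0 * f0') 5 5 := by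
  refine ⟨_, isJacobianResolution_X_zero_mul_f0'.isMinGenSyz_castLE (by decide) (fun j hj => ?_)
    (fun i => ?_) (fun i => ?_) (fun i l => ?_) (by decide)⟩
  · obtain rfl | rfl : j = 2 ∨ j = 3 := by omega
    · rfl
    · rfl
  · fin_cases i <;> exact map_zero _
  · fin_cases i <;> exact map_zero _
  · fin_cases i <;> fin_cases l <;> exact isHomogeneous_form (by decide)

theorem isNearlyFreeWith_X_one_mul_f0' : IsNearlyFreeWith (X 1 * f0') 11 5 6 := by
  refine ⟨rfl, _, isJacobianResolution_X_one_mul_f0'.isMinGenSyz_castLE (by decide) (fun j hj => ?_)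
    (fun i => ?_) (fun i => ?_) (fun i l => ?_) (by decide)⟩
  · obtain rfl : j = 3 := by omega
    rfl
  · fin_cases i <;> exact constantCoeff_form (by decide) (by decide)
  · fin_cases i <;> exact map_zero _
  · fin_cases i <;> fin_cases l <;> exact isHomogeneous_form (by decide)

theorem isNearlyFreeWith_X_mul_X_mul_X_mul_f0' : IsNearlyFreeWith (X 0 * X 1 * X 2 * f0') 13 6 7 := by
  refine ⟨rfl, _, isJacobianResolution_X_mul_X_mul_X_mul_f0'.isMinGenSyz_castLE (by decide) (fun j hj => ?_)
    (fun i => ?_) (fun i => ?_) (fun i l => ?_) (by decide)⟩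
  · obtain rfl : j = 3 := by omega
    rfl
  · fin_cases i <;> exact constantCoeff_form (by decide) (by decide)
  · fin_cases i <;> exact map_zero _
  · fin_cases i <;> fin_cases l <;> exact isHomogeneous_form (by decide)

/-- Adding the inflectional lines `L_x : x = 0`, `L_y : y = 0`, `L_z : z = 0` to `C₀` and
`C'₀`: `C₀ ∪ L_x` is nearly free with exponents `(5,6)`; `C₀ ∪ L_y` is maximal Tjurina of
type `(11,6)`; `C₀ ∪ L_x ∪ L_y ∪ L_z` is maximal Tjurina of type `(13,7)`; `C'₀ ∪ L_x` is
free with exponents `(5,5)`; `C'₀ ∪ L_y` is nearly free with exponents `(5,6)`; and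
`C'₀ ∪ L_x ∪ L_y ∪ L_z` is nearly free with exponents `(6,7)`. -/
theorem statement11 :
    IsNearlyFreeWith (X 0 * f0) 11 5 6 ∧
    IsMaxTjurina (X 1 * f0) 11 6 ∧
    IsMaxTjurina (X 0 * X 1 * X 2 * f0) 13 7 ∧
    IsFreeWith (X 0 * f0') 5 5 ∧
    IsNearlyFreeWith (X 1 * f0') 11 5 6 ∧
    IsNearlyFreeWith (X 0 * X 1 * X 2 * f0') 13 6 7 :=
  ⟨isNearlyFreeWith_X_zero_mul_f0, isMaxTjurina_X_one_mul_f0,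
    isMaxTjurina_X_mul_X_mul_X_mul_f0, isFreeWith_X_zero_mul_f0',
    isNearlyFreeWith_X_one_mul_f0', isNearlyFreeWith_X_mul_X_mul_X_mul_f0'⟩

end
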